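/- Let m ∈ {0,1,2} and let n ∈ ℕ with 3 ∤ n and m = 0. Then H_{2,0,3}(n) = −2·δ_{n≡2 (mod 3)}·∑_{d∣n, d²<n} d³ + ( (1/2)·n·σ(n) − (1/2)·a(n) if n ≡ 1 (mod 3); n·σ(n) − 2n·∑_{d∣n, d²<n} d if n ≡ 2 (mod 3) ). -/

import Mathlib

open scoped BigOperators

namespace HurwitzPaper

set_option linter.all false

/-- Evaluation of the binary quadratic form `(a,b,c)` (i.e. `a x² + b x y + c y²`). -/
def formEval (Q : ℤ × ℤ × ℤ) (x y : ℤ) : ℤ :=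
  Q.1 * x ^ 2 + Q.2.1 * x * y + Q.2.2 * y ^ 2

/-- Discriminant `b² - 4ac` of the form `(a,b,c)`. -/
def formDisc (Q : ℤ × ℤ × ℤ) : ℤ := Q.2.1 ^ 2 - 4 * Q.1 * Q.2.2

/-- Right action of `γ ∈ SL₂(ℤ)` on a binary quadratic form: `(Q∘γ)(x,y) = Q(ax+by, cx+dy)`. -/
def formAct (γ : Matrix.SpecialLinearGroup (Fin 2) ℤ) (Q : ℤ × ℤ × ℤ) : ℤ × ℤ × ℤ :=
  (formEval Q (γ.1 0 0) (γ.1 1 0),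
   formEval Q (γ.1 0 0 + γ.1 0 1) (γ.1 1 0 + γ.1 1 1)
     - formEval Q (γ.1 0 0) (γ.1 1 0) - formEval Q (γ.1 0 1) (γ.1 1 1),
   formEval Q (γ.1 0 1) (γ.1 1 1))

/-- A form is positive definite iff its leading coefficient is positive and its
discriminant is negative. -/
def IsPosDef (Q : ℤ × ℤ × ℤ) : Prop := 0 < Q.1 ∧ formDisc Q < 0

/-- `SL₂(ℤ)`-equivalence classes of positive definite integral binary quadratic forms
of discriminant `-N`. -/
abbrev FormClasses (N : ℤ) :=
  Quot (fun (Q Q' : {Q : ℤ × ℤ × ℤ // formDisc Q = -N ∧ IsPosDef Q}) =>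
    ∃ γ : Matrix.SpecialLinearGroup (Fin 2) ℤ, formAct γ Q.1 = Q'.1)

/-- The Hurwitz class number `H(N)`: each class of positive definite forms of
discriminant `-N` is counted with weight `1/ω_Q = 2/#Γ_Q`, where `Γ_Q` is the stabilizer
of (a representative of) the class in `SL₂(ℤ)`; `H(0) = -1/12`, and `H(N) = 0` when no
such forms exist (in particular for `N < 0` and `N ≡ 1, 2 (mod 4)`). -/
noncomputable def hurwitzClassNumber (N : ℤ) : ℝ :=
  if N = 0 then -(1 / 12)
  else ∑ᶠ c : FormClasses N,
    (2 : ℝ) / (Nat.card {γ : Matrix.SpecialLinearGroup (Fin 2) ℤ //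
      formAct γ c.out.1 = c.out.1})

/-- `H_{κ,m,M}(n) = ∑_{t ≡ m (mod M)} t^κ H(4n - t²)`. -/
noncomputable def HH (κ : ℕ) (m : ℤ) (M : ℕ) (n : ℕ) : ℝ :=
  ∑ᶠ t : ℤ, if t % (M : ℤ) = m % (M : ℤ) then
    (t : ℝ) ^ κ * hurwitzClassNumber (4 * n - t ^ 2) else 0

/-- `a(n)`: the `n`-th Fourier coefficient of `η(3τ)⁸ = q ∏_{k≥1} (1-q^{3k})⁸`
(the factors with `k > n` do not affect the coefficient of `q^n`). -/
noncomputable def etaCoeff (n : ℕ) : ℤ :=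
  Polynomial.coeff (Polynomial.X * ∏ k ∈ Finset.Icc 1 n, (1 - Polynomial.X ^ (3 * k)) ^ 8 : Polynomial ℤ) n




abbrev F4 := ℤ → ℤ → ℤ → ℤ → ℚ
abbrev F3 := ℤ → ℤ → ℤ → ℚ

/-- quadruples of positive integers with `A D + x y = n` -/
noncomputable def Kset (n : ℤ) : Finset (ℤ × ℤ × ℤ × ℤ) :=
  ((Finset.Icc 1 n) ×ˢ (Finset.Icc 1 n) ×ˢ (Finset.Icc 1 n) ×ˢ (Finset.Icc 1 n)).filter
    (fun v => v.1 * v.2.1 + v.2.2.1 * v.2.2.2 = n)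

/-- path set : quadruples `(z, A, y, x)` of positive integers with `z A + A y + y x = n` -/
noncomputable def Pset (n : ℤ) : Finset (ℤ × ℤ × ℤ × ℤ) :=
  ((Finset.Icc 1 n) ×ˢ (Finset.Icc 1 n) ×ˢ (Finset.Icc 1 n) ×ˢ (Finset.Icc 1 n)).filter
    (fun v => v.1 * v.2.1 + v.2.1 * v.2.2.1 + v.2.2.1 * v.2.2.2 = n)

/-- ties: `(A, x, d)` with `d (A + x) = n` -/
noncomputable def Tset (n : ℤ) : Finset (ℤ × ℤ × ℤ) :=
  ((Finset.Icc 1 n) ×ˢ (Finset.Icc 1 n) ×ˢ (Finset.Icc 1 n)).filter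
    (fun v => v.2.2 * (v.1 + v.2.1) = n)

lemma mem_K {n A D x y : ℤ} :
    (A, D, x, y) ∈ Kset n ↔ 0 < A ∧ 0 < D ∧ 0 < x ∧ 0 < y ∧ A * D + x * y = n := by
  simp only [Kset, Finset.mem_filter, Finset.mem_product, Finset.mem_Icc]
  constructor
  · rintro ⟨⟨h1, h2, h3, h4⟩, h5⟩
    exact ⟨by linarith, by linarith, by linarith, by linarith, h5⟩
  · rintro ⟨h1, h2, h3, h4, h5⟩
    refine ⟨⟨⟨h1, ?_⟩, ⟨h2, ?_⟩, ⟨h3, ?_⟩, ⟨h4, ?_⟩⟩, h5⟩ <;> nlinarith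

lemma mem_P {n z A y x : ℤ} :
    (z, A, y, x) ∈ Pset n ↔ 0 < z ∧ 0 < A ∧ 0 < y ∧ 0 < x ∧ z * A + A * y + y * x = n := by
  simp only [Pset, Finset.mem_filter, Finset.mem_product, Finset.mem_Icc]
  constructor
  · rintro ⟨⟨h1, h2, h3, h4⟩, h5⟩
    exact ⟨by linarith, by linarith, by linarith, by linarith, h5⟩
  · rintro ⟨h1, h2, h3, h4, h5⟩
    have := mul_pos h1 h2
    have := mul_pos h2 h3
    have := mul_pos h3 h4
    refine ⟨⟨⟨h1, ?_⟩, ⟨h2, ?_⟩, ⟨h3, ?_⟩, ⟨h4, ?_⟩⟩, h5⟩ <;> nlinarith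

lemma mem_T {n A x d : ℤ} :
    (A, x, d) ∈ Tset n ↔ 0 < A ∧ 0 < x ∧ 0 < d ∧ d * (A + x) = n := by
  simp only [Tset, Finset.mem_filter, Finset.mem_product, Finset.mem_Icc]
  constructor
  · rintro ⟨⟨h1, h2, h3⟩, h5⟩
    exact ⟨by linarith, by linarith, by linarith, h5⟩
  · rintro ⟨h1, h2, h3, h5⟩
    refine ⟨⟨⟨h1, ?_⟩, ⟨h2, ?_⟩, ⟨h3, ?_⟩⟩, h5⟩ <;> nlinarith

/-- sum over `Kset` -/
noncomputable def Ks (n : ℤ) (g : ℤ → ℤ → ℤ → ℤ → ℚ) : ℚ := ∑ v ∈ Kset n, g v.1 v.2.1 v.2.2.1 v.2.2.2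
/-- sum over `Pset` -/
noncomputable def Ps (n : ℤ) (g : ℤ → ℤ → ℤ → ℤ → ℚ) : ℚ := ∑ v ∈ Pset n, g v.1 v.2.1 v.2.2.1 v.2.2.2
/-- sum over `Tset` -/
noncomputable def Ts (n : ℤ) (g : ℤ → ℤ → ℤ → ℚ) : ℚ := ∑ v ∈ Tset n, g v.1 v.2.1 v.2.2

lemma Ks_congr {n : ℤ} {g h : ℤ → ℤ → ℤ → ℤ → ℚ}
    (H : ∀ A D x y, 0 < A → 0 < D → 0 < x → 0 < y → A * D + x * y = n → g A D x y = h A D x y) :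
    Ks n g = Ks n h := by
  refine Finset.sum_congr rfl ?_
  rintro ⟨A, D, x, y⟩ hv
  obtain ⟨h1, h2, h3, h4, h5⟩ := mem_K.1 hv
  exact H A D x y h1 h2 h3 h4 h5

lemma Ps_congr {n : ℤ} {g h : ℤ → ℤ → ℤ → ℤ → ℚ}
    (H : ∀ z A y x, 0 < z → 0 < A → 0 < y → 0 < x → z * A + A * y + y * x = n →
      g z A y x = h z A y x) :
    Ps n g = Ps n h := by
  refine Finset.sum_congr rfl ?_
  rintro ⟨A, D, x, y⟩ hv
  obtain ⟨h1, h2, h3, h4, h5⟩ := mem_P.1 hv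
  exact H A D x y h1 h2 h3 h4 h5

lemma Ts_congr {n : ℤ} {g h : ℤ → ℤ → ℤ → ℚ}
    (H : ∀ A x d, 0 < A → 0 < x → 0 < d → d * (A + x) = n → g A x d = h A x d) :
    Ts n g = Ts n h := by
  refine Finset.sum_congr rfl ?_
  rintro ⟨A, x, d⟩ hv
  obtain ⟨h1, h2, h3, h5⟩ := mem_T.1 hv
  exact H A x d h1 h2 h3 h5

lemma Ks_add (n : ℤ) (g h : F4) : Ks n (fun A D x y => g A D x y + h A D x y) = Ks n g + Ks n h :=
  Finset.sum_add_distrib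
lemma Ps_add (n : ℤ) (g h : F4) : Ps n (fun A D x y => g A D x y + h A D x y) = Ps n g + Ps n h :=
  Finset.sum_add_distrib
lemma Ts_add (n : ℤ) (g h : F3) : Ts n (fun A D x => g A D x + h A D x) = Ts n g + Ts n h :=
  Finset.sum_add_distrib
lemma Ks_sub (n : ℤ) (g h : F4) : Ks n (fun A D x y => g A D x y - h A D x y) = Ks n g - Ks n h :=
  Finset.sum_sub_distrib _ _
lemma Ps_sub (n : ℤ) (g h : F4) : Ps n (fun A D x y => g A D x y - h A D x y) = Ps n g - Ps n h :=
  Finset.sum_sub_distrib _ _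
lemma Ts_sub (n : ℤ) (g h : F3) : Ts n (fun A D x => g A D x - h A D x) = Ts n g - Ts n h :=
  Finset.sum_sub_distrib _ _
lemma Ks_smul (n : ℤ) (c : ℚ) (g : F4) : Ks n (fun A D x y => c * g A D x y) = c * Ks n g :=
  (Finset.mul_sum _ _ _).symm
lemma Ps_smul (n : ℤ) (c : ℚ) (g : F4) : Ps n (fun A D x y => c * g A D x y) = c * Ps n g :=
  (Finset.mul_sum _ _ _).symm
lemma Ts_smul (n : ℤ) (c : ℚ) (g : F3) : Ts n (fun A D x => c * g A D x) = c * Ts n g :=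
  (Finset.mul_sum _ _ _).symm

lemma Ks_alpha (n : ℤ) (g : F4) : Ks n g = Ks n (fun A D x y => g D A x y) := by
  refine Finset.sum_nbij' (fun v => (v.2.1, v.1, v.2.2.1, v.2.2.2))
    (fun v => (v.2.1, v.1, v.2.2.1, v.2.2.2)) ?_ ?_ ?_ ?_ ?_ <;> rintro ⟨A, D, x, y⟩ <;>
    simp [mem_K, mul_comm] <;> grind

lemma Ks_swap (n : ℤ) (g : F4) : Ks n g = Ks n (fun A D x y => g x y A D) := by
  refine Finset.sum_nbij' (fun v => (v.2.2.1, v.2.2.2, v.1, v.2.1))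
    (fun v => (v.2.2.1, v.2.2.2, v.1, v.2.1)) ?_ ?_ ?_ ?_ ?_ <;> rintro ⟨A, D, x, y⟩ <;>
    simp [mem_K] <;> grind

lemma Ks_beta (n : ℤ) (g : F4) : Ks n g = Ks n (fun A D x y => g A D y x) := by
  rw [Ks_swap, Ks_alpha, Ks_swap]

lemma Ps_rev (n : ℤ) (g : F4) : Ps n g = Ps n (fun z A y x => g x y A z) := by
  refine Finset.sum_nbij' (fun v => (v.2.2.2, v.2.2.1, v.2.1, v.1))
    (fun v => (v.2.2.2, v.2.2.1, v.2.1, v.1)) ?_ ?_ ?_ ?_ ?_ <;> rintro ⟨A, D, x, y⟩ <;>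
    simp [mem_P] <;> grind

lemma Ts_rev (n : ℤ) (g : F3) : Ts n g = Ts n (fun A x d => g x A d) := by
  refine Finset.sum_nbij' (fun v => (v.2.1, v.1, v.2.2))
    (fun v => (v.2.1, v.1, v.2.2)) ?_ ?_ ?_ ?_ ?_ <;> rintro ⟨A, x, d⟩ <;>
    simp [mem_T] <;> grind

lemma Ks_gt (n : ℤ) (g : F4) : Ks n (fun A D x y => if y < D then g A D x y else 0)
    = Ps n (fun z A y x => g A (y + z) x y) := by
  unfold Ks
  rw [← Finset.sum_filter]
  refine Finset.sum_nbij' (fun v => (v.2.1 - v.2.2.2, v.1, v.2.2.2, v.2.2.1))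
    (fun v => (v.2.1, v.2.2.1 + v.1, v.2.2.2, v.2.2.1)) ?_ ?_ ?_ ?_ ?_ <;> 
    rintro ⟨A, D, x, y⟩ <;>
    simp [mem_K, mem_P] <;> grind

lemma Ks_eq (n : ℤ) (g : F4) : Ks n (fun A D x y => if y = D then g A D x y else 0)
    = Ts n (fun A x d => g A d x d) := by
  unfold Ks
  rw [← Finset.sum_filter]
  refine Finset.sum_nbij' (fun v => (v.1, v.2.2.1, v.2.1))
    (fun v => (v.1, v.2.2, v.2.1, v.2.2)) ?_ ?_ ?_ ?_ ?_
  · rintro ⟨A, D, x, y⟩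
    simp [mem_K, mem_T]; grind
  · rintro ⟨A, x, d⟩
    simp [mem_K, mem_T]; grind
  · rintro ⟨A, D, x, y⟩
    simp [mem_K]; grind
  · rintro ⟨A, x, d⟩
    simp
  · rintro ⟨A, D, x, y⟩
    simp only [Finset.mem_filter]
    rintro ⟨h, rfl⟩
    rfl

lemma Ks_lt (n : ℤ) (g : F4) : Ks n (fun A D x y => if D < y then g A D x y else 0)
    = Ps n (fun z A y x => g x y A (y + z)) := by
  rw [Ks_swap, Ks_gt n (fun A D x y => g x y A D)]

lemma Ks_main (n : ℤ) (g : F4) : Ks n g = Ps n (fun z A y x => g A (y + z) x y + g x y A (y + z))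
    + Ts n (fun A x d => g A d x d) := by
  rw [Ps_add, ← Ks_gt, ← Ks_eq, ← Ks_lt, ← Ks_add, ← Ks_add]
  refine Ks_congr fun A D x y _ _ _ _ _ => ?_
  rcases lt_trichotomy y D with h | h | h
  · simp [h, h.ne, h.not_gt]
  · simp [h]
  · simp [h, h.ne', h.not_gt]

lemma Ps_sym (n : ℤ) (g : F4) (H : ∀ z A y x, 0 < z → 0 < A → 0 < y → 0 < x → z * A + A * y + y * x = n →
    g z A y x + g x y A z = 0) : Ps n g = 0 := by
  have h1 : Ps n g + Ps n g = 0 := by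
    nth_rewrite 2 [Ps_rev]
    rw [← Ps_add]
    exact Finset.sum_eq_zero (by
      rintro ⟨z, A, y, x⟩ hv
      obtain ⟨h1, h2, h3, h4, h5⟩ := mem_P.1 hv
      exact H z A y x h1 h2 h3 h4 h5)
  linarith

/-- certificate lemma -/
lemma cert (n : ℤ) (F g : F4) (H : ∀ z A y x, 0 < z → 0 < A → 0 < y → 0 < x →
    z * A + A * y + y * x = n →
    (F z A y x + (g A (y + z) x y + g x y A (y + z) - g (y + z) A x y - g y x A (y + z)))
    + (F x y A z + (g y (A + x) z A + g z A y (A + x) - g (A + x) y z A - g A z y (A + x))) = 0) :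
    Ps n F = Ts n (fun A x d => g A d x d - g d A x d) := by
  have h1 := Ks_main n g
  have h2 := Ks_main n (fun A D x y => g D A x y)
  have h3 := Ks_alpha n g
  have h4 := Ps_sym n (fun z A y x => F z A y x +
    (g A (y + z) x y + g x y A (y + z) - g (y + z) A x y - g y x A (y + z))) (by
      intro z A y x hz hA hy hx h
      exact H z A y x hz hA hy hx h)
  simp only [Ps_add, Ps_sub, Ts_sub] at *
  linarith


/-- indicator of zero mod 3 -/
def I3 (m : ZMod 3) : ℤ := if m = 0 then 1 else 0
/-- character mod 3 -/
def X3 (m : ZMod 3) : ℤ := if m = 0 then 0 else if m = 1 then 1 else -1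

/-- indicator of `3 ∣ m` -/
noncomputable def i3 (m : ℤ) : ℚ := I3 (m : ZMod 3)
/-- the nontrivial character mod 3 -/
noncomputable def c3 (m : ℤ) : ℚ := X3 (m : ZMod 3)

lemma z3cases : ∀ a : ZMod 3, a = 0 ∨ a = 1 ∨ a = 2 := by decide

/-- `t² 1_{3∣t}` -/
noncomputable def ff (t : ℤ) : ℚ := i3 t * (t : ℚ) ^ 2

noncomputable def g0 : F4 := fun A D x _ => i3 D * c3 A * c3 x * A * D

noncomputable def gA : F4 := fun A D x y =>
  -(i3 (x-y)*A*A + i3 (x+y)*A*A - 8*i3 (D-x-y)*A*D + 2*i3 (D-x-y)*A*y - 2*i3 (D-x-y)*D*y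
  + 3*i3 (D-x+y)*A*D + 4*i3 (D-y)*D*y + i3 (D+x-y)*(A*A+x*x+y*y) + 2*i3 (D+x)*D*y
  + 2*i3 (D+x+y)*D*x + 1/2*i3 (A-D-x)*y*y + 2*i3 (A-D)*D*D + 1/2*i3 (A-D+y)*x*x
  + 5*i3 (A-D+x)*A*D + 3/2*i3 (A-x+y)*A*A + 2*i3 (A-y)*A*x + 3/2*i3 (A+x-y)*A*A
  + 4*i3 (A+x)*A*x + 2*i3 (A+x+y)*D*x)



lemma certK (n : ℤ) (f g : F4) (H : ∀ z A y x, 0 < z → 0 < A → 0 < y → 0 < x →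
    z * A + A * y + y * x = n →
    (-(f A (y + z) x y + f x y A (y + z)) +
      (g A (y + z) x y + g x y A (y + z) - g (y + z) A x y - g y x A (y + z)))
    + (-(f y (A + x) z A + f z A y (A + x)) +
      (g y (A + x) z A + g z A y (A + x) - g (A + x) y z A - g A z y (A + x))) = 0) :
    Ks n f = Ts n (fun A x d => f A d x d - (g A d x d - g d A x d)) := by
  have h := cert n (fun z A y x => (-1) * (f A (y + z) x y + f x y A (y + z))) g (by
    intro z A y x hz hA hy hx h
    have := H z A y x hz hA hy hx h
    linarith)
  rw [Ks_main, Ts_sub]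
  rw [Ps_smul] at h
  linarith

set_option maxHeartbeats 4000000 in
lemma certA (n : ℤ) (hn : (n : ZMod 3) = 1) :
    Ps n (fun z A y x => ff (x-z) + ff (x+y) - ff (z+A+y) - ff (z+A+y+x)
      - 18 * (g0 A (y+z) x y + g0 x y A (y+z))) = Ts n (fun A x d => gA A d x d - gA d A x d) := by
  refine cert n _ gA fun z A y x _ _ _ _ h => ?_
  simp only [ff, g0, gA, i3, c3]
  rw [← h] at hn
  push_cast at hn ⊢
  generalize (z : ZMod 3) = z0 at *
  generalize (A : ZMod 3) = A0 at *
  generalize (y : ZMod 3) = y0 at *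
  generalize (x : ZMod 3) = x0 at *
  rcases z3cases z0 with rfl | rfl | rfl <;> rcases z3cases A0 with rfl | rfl | rfl <;>
  rcases z3cases y0 with rfl | rfl | rfl <;> rcases z3cases x0 with rfl | rfl | rfl <;>
  first
  | (exfalso; revert hn; decide)
  | (simp (decide := true) only [I3, X3, if_true, if_false, Int.cast_zero,
      Int.cast_one, Int.cast_neg, mul_zero, zero_mul, mul_one, one_mul, add_zero, zero_add, sub_zero]; ring)

noncomputable def fII : F4 := fun A _ x _ => c3 A * c3 x

noncomputable def gII : F4 := fun _ D x y =>
  (-1/3)*i3 (D-x) + (-1/3)*i3 (D-y) + (-2/3)*i3 (D) + (2/3)*i3 (D+y) + (2/3)*i3 (D+x)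

set_option maxHeartbeats 4000000 in
lemma certII (n : ℤ) :
    Ks n fII = Ts n (fun A x d => fII A d x d - (gII A d x d - gII d A x d)) := by
  refine certK n _ gII fun z A y x _ _ _ _ h => ?_
  simp only [fII, gII, i3, c3]
  push_cast
  generalize (z : ZMod 3) = z0
  generalize (A : ZMod 3) = A0
  generalize (y : ZMod 3) = y0
  generalize (x : ZMod 3) = x0
  rcases z3cases z0 with rfl | rfl | rfl <;> rcases z3cases A0 with rfl | rfl | rfl <;>
  rcases z3cases y0 with rfl | rfl | rfl <;> rcases z3cases x0 with rfl | rfl | rfl <;>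
  first
  | (simp (decide := true) only [I3, X3, if_true, if_false, Int.cast_zero,
      Int.cast_one, Int.cast_neg, mul_zero, zero_mul, mul_one, one_mul, add_zero, zero_add, sub_zero]; ring)

noncomputable def fX0 : F4 := fun A D x _ => A * c3 x * (1 - i3 D)

noncomputable def gX0 : F4 := fun A D x y =>
  (1/3)*c3 (x)*A + (1/6)*c3 (D-x-y)*x + (-1/6)*c3 (D-x+y)*x + (-2/3)*c3 (D)*A
    + (1/6)*c3 (A-D-x)*x + (-1/6)*c3 (A-D-x+y)*x + (1/3)*c3 (A+x)*D

set_option maxHeartbeats 4000000 in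
lemma certX0 (n : ℤ) (hn : (n : ZMod 3) = 0) :
    Ks n fX0 = Ts n (fun A x d => fX0 A d x d - (gX0 A d x d - gX0 d A x d)) := by
  refine certK n _ gX0 fun z A y x _ _ _ _ h => ?_
  simp only [fX0, gX0, i3, c3]
  rw [← h] at hn
  push_cast at hn ⊢
  generalize (z : ZMod 3) = z0 at *
  generalize (A : ZMod 3) = A0 at *
  generalize (y : ZMod 3) = y0 at *
  generalize (x : ZMod 3) = x0 at *
  rcases z3cases z0 with rfl | rfl | rfl <;> rcases z3cases A0 with rfl | rfl | rfl <;>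
  rcases z3cases y0 with rfl | rfl | rfl <;> rcases z3cases x0 with rfl | rfl | rfl <;>
  first
  | (exfalso; revert hn; decide)
  | (simp (decide := true) only [I3, X3, if_true, if_false, Int.cast_zero,
      Int.cast_one, Int.cast_neg, mul_zero, zero_mul, mul_one, one_mul, add_zero, zero_add, sub_zero]; ring)

noncomputable def fX1 : F4 := fun A D x _ => A * c3 x * (1 - i3 D)

noncomputable def gX1 : F4 := fun A D x y =>
  (1/3)*c3 (x)*A + (1/3)*c3 (D-x)*x + (-2/3)*c3 (D)*A + (-1/3)*c3 (D)*x + (1/3)*c3 (A+x)*D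

set_option maxHeartbeats 4000000 in
lemma certX1 (n : ℤ) (hn : (n : ZMod 3) = 1) :
    Ks n fX1 = Ts n (fun A x d => fX1 A d x d - (gX1 A d x d - gX1 d A x d)) := by
  refine certK n _ gX1 fun z A y x _ _ _ _ h => ?_
  simp only [fX1, gX1, i3, c3]
  rw [← h] at hn
  push_cast at hn ⊢
  generalize (z : ZMod 3) = z0 at *
  generalize (A : ZMod 3) = A0 at *
  generalize (y : ZMod 3) = y0 at *
  generalize (x : ZMod 3) = x0 at *
  rcases z3cases z0 with rfl | rfl | rfl <;> rcases z3cases A0 with rfl | rfl | rfl <;>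
  rcases z3cases y0 with rfl | rfl | rfl <;> rcases z3cases x0 with rfl | rfl | rfl <;>
  first
  | (exfalso; revert hn; decide)
  | (simp (decide := true) only [I3, X3, if_true, if_false, Int.cast_zero,
      Int.cast_one, Int.cast_neg, mul_zero, zero_mul, mul_one, one_mul, add_zero, zero_add, sub_zero]; ring)

noncomputable def fX2 : F4 := fun A D x _ => A * c3 x * (1 - i3 D)

noncomputable def gX2 : F4 := fun A D x y =>
  (2/3)*c3 (D-x+y)*x + (-1/2)*c3 (D-x+y)*y + (-1/2)*c3 (D)*A + (1/6)*c3 (D+y)*x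
    + (-1/6)*c3 (A-D-x)*x + (1/2)*c3 (A-D-x+y)*D + (1/6)*c3 (A)*x + (1/2)*c3 (A+D-x-y)*D
    + (1/2)*c3 (A+D-x)*A

set_option maxHeartbeats 4000000 in
lemma certX2 (n : ℤ) (hn : (n : ZMod 3) = 2) :
    Ks n fX2 = Ts n (fun A x d => fX2 A d x d - (gX2 A d x d - gX2 d A x d)) := by
  refine certK n _ gX2 fun z A y x _ _ _ _ h => ?_
  simp only [fX2, gX2, i3, c3]
  rw [← h] at hn
  push_cast at hn ⊢
  generalize (z : ZMod 3) = z0 at *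
  generalize (A : ZMod 3) = A0 at *
  generalize (y : ZMod 3) = y0 at *
  generalize (x : ZMod 3) = x0 at *
  rcases z3cases z0 with rfl | rfl | rfl <;> rcases z3cases A0 with rfl | rfl | rfl <;>
  rcases z3cases y0 with rfl | rfl | rfl <;> rcases z3cases x0 with rfl | rfl | rfl <;>
  first
  | (exfalso; revert hn; decide)
  | (simp (decide := true) only [I3, X3, if_true, if_false, Int.cast_zero,
      Int.cast_one, Int.cast_neg, mul_zero, zero_mul, mul_one, one_mul, add_zero, zero_add, sub_zero]; ring)

noncomputable def fY : F4 := fun A D x _ => A * c3 x * i3 (A * D + 1)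

noncomputable def gY : F4 := fun A D x y =>
  (-1/6)*c3 (x+y)*A + (1/6)*c3 (D-x-y)*D + (1/6)*c3 (D-x-y)*x + (-1/6)*c3 (D-x+y)*x
    + (1/6)*c3 (D-x+y)*y + (-1/3)*c3 (D)*A + (1/6)*c3 (D+x+y)*A + (1/6)*c3 (A+x+y)*y
    + (1/6)*c3 (A+D-x-y)*A

set_option maxHeartbeats 4000000 in
lemma certY (n : ℤ) (hn : (n : ZMod 3) = 0) :
    Ks n fY = Ts n (fun A x d => fY A d x d - (gY A d x d - gY d A x d)) := by
  refine certK n _ gY fun z A y x _ _ _ _ h => ?_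
  simp only [fY, gY, i3, c3]
  rw [← h] at hn
  push_cast at hn ⊢
  generalize (z : ZMod 3) = z0 at *
  generalize (A : ZMod 3) = A0 at *
  generalize (y : ZMod 3) = y0 at *
  generalize (x : ZMod 3) = x0 at *
  rcases z3cases z0 with rfl | rfl | rfl <;> rcases z3cases A0 with rfl | rfl | rfl <;>
  rcases z3cases y0 with rfl | rfl | rfl <;> rcases z3cases x0 with rfl | rfl | rfl <;>
  first
  | (exfalso; revert hn; decide)
  | (simp (decide := true) only [I3, X3, if_true, if_false, Int.cast_zero,
      Int.cast_one, Int.cast_neg, mul_zero, zero_mul, mul_one, one_mul, add_zero, zero_add, sub_zero]; ring)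

noncomputable def fG : F4 := fun A D x _ => i3 D * A * c3 x - 3 * (i3 A * i3 D * A * c3 x)

noncomputable def gG : F4 := fun A D x y =>
  (1/30)*c3 (D-x-y)*D + (-11/45)*c3 (D-x-y)*y + (-1/5)*c3 (D-x)*D + (4/45)*c3 (D-x)*x
    + (-1/5)*c3 (D)*D + (1/18)*c3 (D+x+y)*x + (17/90)*c3 (D+x+y)*y + (-7/30)*c3 (A-D-x-y)*A
    + (4/45)*c3 (A-D-x+y)*A + (2/45)*c3 (A-D-x+y)*D + (-13/30)*c3 (A-D-y)*D + (4/45)*c3 (A+y)*x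
    + (1/10)*c3 (A+x+y)*A + (1/30)*c3 (A+D)*D

set_option maxHeartbeats 4000000 in
lemma certG (n : ℤ) (hn : (n : ZMod 3) = 1) :
    Ks n fG = Ts n (fun A x d => fG A d x d - (gG A d x d - gG d A x d)) := by
  refine certK n _ gG fun z A y x _ _ _ _ h => ?_
  simp only [fG, gG, i3, c3]
  rw [← h] at hn
  push_cast at hn ⊢
  generalize (z : ZMod 3) = z0 at *
  generalize (A : ZMod 3) = A0 at *
  generalize (y : ZMod 3) = y0 at *
  generalize (x : ZMod 3) = x0 at *
  rcases z3cases z0 with rfl | rfl | rfl <;> rcases z3cases A0 with rfl | rfl | rfl <;>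
  rcases z3cases y0 with rfl | rfl | rfl <;> rcases z3cases x0 with rfl | rfl | rfl <;>
  first
  | (exfalso; revert hn; decide)
  | (simp (decide := true) only [I3, X3, if_true, if_false, Int.cast_zero,
      Int.cast_one, Int.cast_neg, mul_zero, zero_mul, mul_one, one_mul, add_zero, zero_add, sub_zero]; ring)

noncomputable def gB : F4 := fun A D x y =>
  (-1/6)*i3 (D-x-y)*A*D + (-2/3)*i3 (D-x-y)*x*x + (-11/6)*i3 (D-x-y)*x*y + (-4/3)*i3 (D+x)*D*x
    + (-1/6)*i3 (D+x+y)*A*D + (-11/6)*i3 (D+x+y)*x*y + (-2/3)*i3 (D+x+y)*y*y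
    + (-2/3)*i3 (A-D+x-y)*A*A + (-1)*i3 (A-D+x-y)*A*D + (-4/3)*i3 (A-y)*A*y
    + (-2/3)*i3 (A+D-x)*A*A + (-4/3)*i3 (A+D-y)*A*A + (-4/3)*i3 (A+D-y)*D*y
    + (-7/3)*i3 (A+D)*A*A + (-2/3)*i3 (A+D+y)*A*A + (-4/3)*i3 (A+D+x)*A*A
    + (-4/3)*i3 (A+D+x)*A*x + (-2/3)*A*x + (-2/3)*D*y

set_option maxHeartbeats 4000000 in
lemma certB (n : ℤ) (hn : (n : ZMod 3) = 2) :
    Ps n (fun z A y x => ff (x-z) + ff (x+y) - ff (z+A+y) - ff (z+A+y+x))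
      = Ts n (fun A x d => gB A d x d - gB d A x d) := by
  refine cert n _ gB fun z A y x _ _ _ _ h => ?_
  simp only [ff, gB, i3, c3]
  rw [← h] at hn
  push_cast at hn ⊢
  generalize (z : ZMod 3) = z0 at *
  generalize (A : ZMod 3) = A0 at *
  generalize (y : ZMod 3) = y0 at *
  generalize (x : ZMod 3) = x0 at *
  rcases z3cases z0 with rfl | rfl | rfl <;> rcases z3cases A0 with rfl | rfl | rfl <;>
  rcases z3cases y0 with rfl | rfl | rfl <;> rcases z3cases x0 with rfl | rfl | rfl <;>
  first
  | (exfalso; revert hn; decide)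
  | (simp (decide := true) only [I3, X3, if_true, if_false, Int.cast_zero,
      Int.cast_one, Int.cast_neg, mul_zero, zero_mul, mul_one, one_mul, add_zero, zero_add, sub_zero]; ring)



/-- pairs of positive integers with product `n` -/
noncomputable def Dset (n : ℤ) : Finset (ℤ × ℤ) :=
  ((Finset.Icc 1 n) ×ˢ (Finset.Icc 1 n)).filter (fun v => v.1 * v.2 = n)

lemma mem_D {n d e : ℤ} : (d, e) ∈ Dset n ↔ 0 < d ∧ 0 < e ∧ d * e = n := by
  simp only [Dset, Finset.mem_filter, Finset.mem_product, Finset.mem_Icc]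
  constructor
  · rintro ⟨⟨h1, h2⟩, h5⟩
    exact ⟨by linarith, by linarith, h5⟩
  · rintro ⟨h1, h2, h5⟩
    refine ⟨⟨⟨h1, ?_⟩, ⟨h2, ?_⟩⟩, h5⟩ <;> nlinarith

/-- divisor sums -/
noncomputable def Ds (n : ℤ) (g : ℤ → ℤ → ℚ) : ℚ := ∑ v ∈ Dset n, g v.1 v.2

lemma Ds_congr {n : ℤ} {g h : ℤ → ℤ → ℚ}
    (H : ∀ d e, 0 < d → 0 < e → d * e = n → g d e = h d e) : Ds n g = Ds n h := by
  refine Finset.sum_congr rfl ?_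
  rintro ⟨A, x⟩ hv
  obtain ⟨h1, h2, h5⟩ := mem_D.1 hv
  exact H A x h1 h2 h5

lemma Ds_add (n : ℤ) (g h : ℤ → ℤ → ℚ) :
    Ds n (fun d e => g d e + h d e) = Ds n g + Ds n h := Finset.sum_add_distrib
lemma Ds_sub (n : ℤ) (g h : ℤ → ℤ → ℚ) :
    Ds n (fun d e => g d e - h d e) = Ds n g - Ds n h := Finset.sum_sub_distrib _ _
lemma Ds_smul (n : ℤ) (c : ℚ) (g : ℤ → ℤ → ℚ) :
    Ds n (fun d e => c * g d e) = c * Ds n g := (Finset.mul_sum _ _ _).symm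

lemma Ds_rev (n : ℤ) (g : ℤ → ℤ → ℚ) : Ds n g = Ds n (fun d e => g e d) := by
  refine Finset.sum_nbij' (fun v => (v.2, v.1)) (fun v => (v.2, v.1)) ?_ ?_ ?_ ?_ ?_ <;>
    rintro ⟨A, x⟩ <;> simp [mem_D] <;> grind

lemma Ds_sym {n : ℤ} {g h : ℤ → ℤ → ℚ}
    (H : ∀ d e, 0 < d → 0 < e → d * e = n → g d e + g e d = h d e + h e d) :
    Ds n g = Ds n h := by
  have h1 := Ds_rev n g
  have h2 := Ds_rev n h
  have h3 : Ds n (fun d e => g d e + g e d) = Ds n (fun d e => h d e + h e d) := Ds_congr H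
  rw [Ds_add, Ds_add] at h3
  linarith

lemma Ts_eval (n : ℤ) (T : F3) :
    Ts n T = Ds n (fun d e => ∑ A ∈ Finset.Ioo 0 e, T A (e - A) d) := by
  unfold Ts Ds
  rw [Finset.sum_sigma']
  refine Finset.sum_nbij' (fun v => ⟨(v.2.2, v.1 + v.2.1), v.1⟩)
    (fun w => (w.2, w.1.2 - w.2, w.1.1)) ?_ ?_ ?_ ?_ ?_
  · rintro ⟨A, x, d⟩
    simp only [Finset.mem_sigma, mem_D, mem_T, Finset.mem_Ioo]
    grind
  · rintro ⟨⟨d, e⟩, A⟩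
    simp only [Finset.mem_sigma, mem_D, mem_T, Finset.mem_Ioo]
    grind
  · rintro ⟨A, x, d⟩; simp
  · rintro ⟨⟨d, e⟩, A⟩; simp
  · rintro ⟨A, x, d⟩; simp

lemma tri0 (u : ℤ → ℚ) (k : ℕ) (h : ∀ l : ℤ, u (3*l) + u (3*l+1) + u (3*l+2) =
    (u 0 + u 1 + u 2) + l * ((u 3 + u 4 + u 5) - (u 0 + u 1 + u 2))
    + l * (l - 1) / 2 * ((u 6 + u 7 + u 8) - 2 * (u 3 + u 4 + u 5) + (u 0 + u 1 + u 2))) :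
    ∑ A ∈ Finset.Ico 0 (3 * (k : ℤ)), u A = k * (u 0 + u 1 + u 2)
      + k * (k - 1) / 2 * ((u 3 + u 4 + u 5) - (u 0 + u 1 + u 2))
      + k * (k - 1) * (k - 2) / 6 *
        ((u 6 + u 7 + u 8) - 2 * (u 3 + u 4 + u 5) + (u 0 + u 1 + u 2)) := by
  induction k with
  | zero => simp
  | succ k ih =>
    have e1 : Finset.Ico 0 (3 * ((k + 1 : ℕ) : ℤ)) =
        insert (3 * (k : ℤ) + 2) (insert (3 * (k : ℤ) + 1) (insert (3 * (k : ℤ))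
          (Finset.Ico 0 (3 * (k : ℤ))))) := by
      ext a; simp only [Finset.mem_Ico, Finset.mem_insert]; push_cast; omega
    rw [e1, Finset.sum_insert (by simp), Finset.sum_insert (by simp), Finset.sum_insert (by simp),
      ih]
    have := h k
    push_cast at this ⊢
    linear_combination this

/-- hypothesis of `tri` sums -/
def Quad (u : ℤ → ℚ) : Prop := ∀ l : ℤ, u (3*l) + u (3*l+1) + u (3*l+2) =
    (u 0 + u 1 + u 2) + l * ((u 3 + u 4 + u 5) - (u 0 + u 1 + u 2))
    + l * (l - 1) / 2 * ((u 6 + u 7 + u 8) - 2 * (u 3 + u 4 + u 5) + (u 0 + u 1 + u 2))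

/-- the closed form -/
noncomputable def triV (u : ℤ → ℚ) (k : ℤ) : ℚ := -u 0 + k * (u 0 + u 1 + u 2)
      + k * (k - 1) / 2 * ((u 3 + u 4 + u 5) - (u 0 + u 1 + u 2))
      + k * (k - 1) * (k - 2) / 6 *
        ((u 6 + u 7 + u 8) - 2 * (u 3 + u 4 + u 5) + (u 0 + u 1 + u 2))

lemma tri_0 (u : ℤ → ℚ) (k : ℤ) (hk : 0 < 3 * k) (h : Quad u) :
    ∑ A ∈ Finset.Ioo 0 (3 * k), u A = triV u k := by
  obtain ⟨k, rfl⟩ := Int.eq_ofNat_of_zero_le (by omega : 0 ≤ k)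
  have h1 := tri0 u k h
  have e1 : Finset.Ico 0 (3 * (k : ℤ)) = insert 0 (Finset.Ioo 0 (3 * (k : ℤ))) := by
    ext a; simp only [Finset.mem_Ico, Finset.mem_insert, Finset.mem_Ioo]; omega
  rw [e1, Finset.sum_insert (by simp)] at h1
  unfold triV
  push_cast
  linarith

lemma tri_1 (u : ℤ → ℚ) (k : ℤ) (hk : 0 < 3 * k + 1) (h : Quad u) :
    ∑ A ∈ Finset.Ioo 0 (3 * k + 1), u A = triV u k + u (3 * k) := by
  obtain ⟨k, rfl⟩ := Int.eq_ofNat_of_zero_le (by omega : 0 ≤ k)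
  have h1 := tri0 u k h
  have e1 : insert (3 * (k : ℤ)) (Finset.Ico 0 (3 * (k : ℤ)))
      = insert 0 (Finset.Ioo 0 (3 * (k : ℤ) + 1)) := by
    ext a; simp only [Finset.mem_Ico, Finset.mem_insert, Finset.mem_Ioo]; omega
  have h2 := congrArg (fun s => ∑ A ∈ s, u A) e1
  rw [Finset.sum_insert (by simp), Finset.sum_insert (by simp)] at h2
  unfold triV
  push_cast
  linarith

lemma tri_2 (u : ℤ → ℚ) (k : ℤ) (hk : 0 < 3 * k + 2) (h : Quad u) :
    ∑ A ∈ Finset.Ioo 0 (3 * k + 2), u A = triV u k + u (3 * k) + u (3 * k + 1) := by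
  obtain ⟨k, rfl⟩ := Int.eq_ofNat_of_zero_le (by omega : 0 ≤ k)
  have h1 := tri_1 u k (by omega) h
  have e1 : insert (3 * (k : ℤ) + 1) (Finset.Ioo 0 (3 * (k : ℤ) + 1))
      = (Finset.Ioo 0 (3 * (k : ℤ) + 2)) := by
    ext a; simp only [Finset.mem_insert, Finset.mem_Ioo]; omega
  rw [← e1, Finset.sum_insert (by simp), h1]
  ring

lemma three0 : (3 : ZMod 3) = 0 := by decide

lemma mod3 (d : ℤ) : ∃ k, d = 3 * k ∨ d = 3 * k + 1 ∨ d = 3 * k + 2 :=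
  ⟨d / 3, by omega⟩

lemma tri_any (u : ℤ → ℚ) (e k : ℤ) (V : ℚ) (he : 0 < e)
    (h : (e = 3 * k ∧ V = triV u k) ∨ (e = 3 * k + 1 ∧ V = triV u k + u (3 * k)) ∨
      (e = 3 * k + 2 ∧ V = triV u k + u (3 * k) + u (3 * k + 1)))
    (hQ : Quad u) : ∑ A ∈ Finset.Ioo 0 e, u A = V := by
  rcases h with ⟨rfl, rfl⟩ | ⟨rfl, rfl⟩ | ⟨rfl, rfl⟩
  · exact tri_0 u k he hQ
  · exact tri_1 u k he hQ
  · exact tri_2 u k he hQ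

lemma Ts_sym {n : ℤ} {g h : F3}
    (H : ∀ A x d, 0 < A → 0 < x → 0 < d → d * (A + x) = n →
      g A x d + g x A d = h A x d + h x A d) : Ts n g = Ts n h := by
  have h1 := Ts_rev n g
  have h2 := Ts_rev n h
  have h3 : Ts n (fun A x d => g A x d + g x A d) = Ts n (fun A x d => h A x d + h x A d) :=
    Ts_congr H
  rw [Ts_add, Ts_add] at h3
  linarith

set_option maxHeartbeats 4000000 in
lemma tieII (n : ℤ) : Ks n fII = Ts n (fun A x d => (1 - i3 (A + x)) * i3 (A - x)) := by
  rw [certII n]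
  refine Ts_sym fun A x d _ _ _ h => ?_
  simp only [fII, gII, i3, c3]
  clear h
  push_cast
  generalize (d : ZMod 3) = d0
  generalize (A : ZMod 3) = A0
  generalize (x : ZMod 3) = x0
  rcases z3cases d0 with rfl | rfl | rfl <;> rcases z3cases A0 with rfl | rfl | rfl <;>
  rcases z3cases x0 with rfl | rfl | rfl <;>
  first
  | (simp (decide := true) only [I3, X3, if_true, if_false,
      Int.cast_zero, Int.cast_one, Int.cast_neg, mul_zero, zero_mul, mul_one, add_zero, zero_add, sub_zero]; ring)

set_option maxHeartbeats 4000000 in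
lemma valII (n : ℤ) : Ks n fII = Ds n (fun d _ => 1/3 * (d - i3 d * d - c3 d)) := by
  rw [tieII n, Ts_eval]
  refine Ds_sym fun d e hd he h => ?_
  clear h
  obtain ⟨k, rfl | rfl | rfl⟩ := mod3 d <;> obtain ⟨l, rfl | rfl | rfl⟩ := mod3 e <;>
  ((first | rw [tri_0 _ k hd] | rw [tri_1 _ k hd] | rw [tri_2 _ k hd]) <;>
     (first | rw [tri_0 _ l he] | rw [tri_1 _ l he] | rw [tri_2 _ l he] | skip) <;>
     simp only [Quad, triV] <;>
     (try intro m) <;>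
     simp only [i3, c3] <;>
     push_cast <;>
     simp (decide := true) only [three0, I3, X3, if_true, if_false,
      Int.cast_zero, Int.cast_one, Int.cast_neg, mul_zero, zero_mul, mul_one, add_zero, zero_add, sub_zero] <;>
     ring)

set_option maxHeartbeats 4000000 in
lemma tieX0 (n : ℤ) (hn : (n : ZMod 3) = 0) : Ks n fX0 = Ts n (fun A x d => i3 (A + x) * c3 d * (A + x) / 2 - i3 d * i3 A * c3 x * d) := by
  rw [certX0 n hn]
  refine Ts_sym fun A x d _ _ _ h => ?_
  simp only [fX0, gX0, i3, c3]
  rw [← h] at hn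
  push_cast at hn ⊢
  generalize (d : ZMod 3) = d0 at *
  generalize (A : ZMod 3) = A0 at *
  generalize (x : ZMod 3) = x0 at *
  rcases z3cases d0 with rfl | rfl | rfl <;> rcases z3cases A0 with rfl | rfl | rfl <;>
  rcases z3cases x0 with rfl | rfl | rfl <;>
  first
  | (exfalso; revert hn; decide)
  | (simp (decide := true) only [I3, X3, if_true, if_false,
      Int.cast_zero, Int.cast_one, Int.cast_neg, mul_zero, zero_mul, mul_one, add_zero, zero_add, sub_zero]; ring)

set_option maxHeartbeats 4000000 in
lemma valX0 (n : ℤ) (hn : (n : ZMod 3) = 0) : Ks n fX0 = Ds n (fun d e => -1/6 * (2 * d * e * c3 d + d - i3 e * d - 3 * c3 e * d * d)) := by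
  rw [tieX0 n hn, Ts_eval]
  refine Ds_sym fun d e hd he h => ?_
  rw [← h] at hn
  push_cast at hn
  obtain ⟨k, rfl | rfl | rfl⟩ := mod3 d <;> obtain ⟨l, rfl | rfl | rfl⟩ := mod3 e <;>
  push_cast [three0, zero_mul, zero_add] at hn <;>
  first
  | (exfalso; revert hn; decide)
  | (clear hn
     (first | rw [tri_0 _ k hd] | rw [tri_1 _ k hd] | rw [tri_2 _ k hd]) <;>
     (first | rw [tri_0 _ l he] | rw [tri_1 _ l he] | rw [tri_2 _ l he] | skip) <;>
     simp only [Quad, triV] <;>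
     (try intro m) <;>
     simp only [i3, c3] <;>
     push_cast <;>
     simp (decide := true) only [three0, I3, X3, if_true, if_false,
      Int.cast_zero, Int.cast_one, Int.cast_neg, mul_zero, zero_mul, mul_one, add_zero, zero_add, sub_zero] <;>
     ring)

set_option maxHeartbeats 4000000 in
lemma tieX1 (n : ℤ) (hn : (n : ZMod 3) = 1) : Ks n fX1 = Ts n (fun A x d => c3 d * (A + x) / 2 - c3 d * i3 A * d) := by
  rw [certX1 n hn]
  refine Ts_sym fun A x d _ _ _ h => ?_
  simp only [fX1, gX1, i3, c3]
  rw [← h] at hn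
  push_cast at hn ⊢
  generalize (d : ZMod 3) = d0 at *
  generalize (A : ZMod 3) = A0 at *
  generalize (x : ZMod 3) = x0 at *
  rcases z3cases d0 with rfl | rfl | rfl <;> rcases z3cases A0 with rfl | rfl | rfl <;>
  rcases z3cases x0 with rfl | rfl | rfl <;>
  first
  | (exfalso; revert hn; decide)
  | (simp (decide := true) only [I3, X3, if_true, if_false,
      Int.cast_zero, Int.cast_one, Int.cast_neg, mul_zero, zero_mul, mul_one, add_zero, zero_add, sub_zero]; ring)

set_option maxHeartbeats 4000000 in
lemma valX1 (n : ℤ) (hn : (n : ZMod 3) = 1) : Ks n fX1 = Ds n (fun d e => -1/6 * (2 * d * e * c3 d + d - i3 e * d - 3 * c3 e * d * d)) := by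
  rw [tieX1 n hn, Ts_eval]
  refine Ds_sym fun d e hd he h => ?_
  rw [← h] at hn
  push_cast at hn
  obtain ⟨k, rfl | rfl | rfl⟩ := mod3 d <;> obtain ⟨l, rfl | rfl | rfl⟩ := mod3 e <;>
  push_cast [three0, zero_mul, zero_add] at hn <;>
  first
  | (exfalso; revert hn; decide)
  | (clear hn
     (first | rw [tri_0 _ k hd] | rw [tri_1 _ k hd] | rw [tri_2 _ k hd]) <;>
     (first | rw [tri_0 _ l he] | rw [tri_1 _ l he] | rw [tri_2 _ l he] | skip) <;>
     simp only [Quad, triV] <;>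
     (try intro m) <;>
     simp only [i3, c3] <;>
     push_cast <;>
     simp (decide := true) only [three0, I3, X3, if_true, if_false,
      Int.cast_zero, Int.cast_one, Int.cast_neg, mul_zero, zero_mul, mul_one, add_zero, zero_add, sub_zero] <;>
     ring)

set_option maxHeartbeats 4000000 in
lemma tieX2 (n : ℤ) (hn : (n : ZMod 3) = 2) : Ks n fX2 = Ts n (fun A x d => c3 d * (2 * A * i3 A + A * i3 (A - d))) := by
  rw [certX2 n hn]
  refine Ts_sym fun A x d _ _ _ h => ?_
  simp only [fX2, gX2, i3, c3]
  rw [← h] at hn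
  push_cast at hn ⊢
  generalize (d : ZMod 3) = d0 at *
  generalize (A : ZMod 3) = A0 at *
  generalize (x : ZMod 3) = x0 at *
  rcases z3cases d0 with rfl | rfl | rfl <;> rcases z3cases A0 with rfl | rfl | rfl <;>
  rcases z3cases x0 with rfl | rfl | rfl <;>
  first
  | (exfalso; revert hn; decide)
  | (simp (decide := true) only [I3, X3, if_true, if_false,
      Int.cast_zero, Int.cast_one, Int.cast_neg, mul_zero, zero_mul, mul_one, add_zero, zero_add, sub_zero]; ring)

set_option maxHeartbeats 4000000 in
lemma valX2 (n : ℤ) (hn : (n : ZMod 3) = 2) : Ks n fX2 = Ds n (fun d e => -1/6 * (2 * d * e * c3 d + d - i3 e * d - 3 * c3 e * d * d)) := by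
  rw [tieX2 n hn, Ts_eval]
  refine Ds_sym fun d e hd he h => ?_
  rw [← h] at hn
  push_cast at hn
  obtain ⟨k, rfl | rfl | rfl⟩ := mod3 d <;> obtain ⟨l, rfl | rfl | rfl⟩ := mod3 e <;>
  push_cast [three0, zero_mul, zero_add] at hn <;>
  first
  | (exfalso; revert hn; decide)
  | (clear hn
     (first | rw [tri_0 _ k hd] | rw [tri_1 _ k hd] | rw [tri_2 _ k hd]) <;>
     (first | rw [tri_0 _ l he] | rw [tri_1 _ l he] | rw [tri_2 _ l he] | skip) <;>
     simp only [Quad, triV] <;>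
     (try intro m) <;>
     simp only [i3, c3] <;>
     push_cast <;>
     simp (decide := true) only [three0, I3, X3, if_true, if_false,
      Int.cast_zero, Int.cast_one, Int.cast_neg, mul_zero, zero_mul, mul_one, add_zero, zero_add, sub_zero] <;>
     ring)

set_option maxHeartbeats 4000000 in
lemma tieY (n : ℤ) (hn : (n : ZMod 3) = 0) : Ks n fY = Ts n (fun A x d => c3 d * i3 (A + x) * (1 - i3 A) * (A + x) / 2) := by
  rw [certY n hn]
  refine Ts_sym fun A x d _ _ _ h => ?_
  simp only [fY, gY, i3, c3]
  rw [← h] at hn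
  push_cast at hn ⊢
  generalize (d : ZMod 3) = d0 at *
  generalize (A : ZMod 3) = A0 at *
  generalize (x : ZMod 3) = x0 at *
  rcases z3cases d0 with rfl | rfl | rfl <;> rcases z3cases A0 with rfl | rfl | rfl <;>
  rcases z3cases x0 with rfl | rfl | rfl <;>
  first
  | (exfalso; revert hn; decide)
  | (simp (decide := true) only [I3, X3, if_true, if_false,
      Int.cast_zero, Int.cast_one, Int.cast_neg, mul_zero, zero_mul, mul_one, add_zero, zero_add, sub_zero]; ring)

set_option maxHeartbeats 4000000 in
lemma valY (n : ℤ) (hn : (n : ZMod 3) = 0) : Ks n fY = Ds n (fun d e => i3 d * c3 e * d * d / 3) := by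
  rw [tieY n hn, Ts_eval]
  refine Ds_sym fun d e hd he h => ?_
  rw [← h] at hn
  push_cast at hn
  obtain ⟨k, rfl | rfl | rfl⟩ := mod3 d <;> obtain ⟨l, rfl | rfl | rfl⟩ := mod3 e <;>
  push_cast [three0, zero_mul, zero_add] at hn <;>
  first
  | (exfalso; revert hn; decide)
  | (clear hn
     (first | rw [tri_0 _ k hd] | rw [tri_1 _ k hd] | rw [tri_2 _ k hd]) <;>
     (first | rw [tri_0 _ l he] | rw [tri_1 _ l he] | rw [tri_2 _ l he] | skip) <;>
     simp only [Quad, triV] <;>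
     (try intro m) <;>
     simp only [i3, c3] <;>
     push_cast <;>
     simp (decide := true) only [three0, I3, X3, if_true, if_false,
      Int.cast_zero, Int.cast_one, Int.cast_neg, mul_zero, zero_mul, mul_one, add_zero, zero_add, sub_zero] <;>
     ring)

set_option maxHeartbeats 4000000 in
lemma tieG (n : ℤ) (hn : (n : ZMod 3) = 1) : Ks n fG = Ts n (fun A x d => c3 d * (i3 A * (A - x + d) + i3 (A + d) * d) / 2) := by
  rw [certG n hn]
  refine Ts_sym fun A x d _ _ _ h => ?_
  simp only [fG, gG, i3, c3]
  rw [← h] at hn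
  push_cast at hn ⊢
  generalize (d : ZMod 3) = d0 at *
  generalize (A : ZMod 3) = A0 at *
  generalize (x : ZMod 3) = x0 at *
  rcases z3cases d0 with rfl | rfl | rfl <;> rcases z3cases A0 with rfl | rfl | rfl <;>
  rcases z3cases x0 with rfl | rfl | rfl <;>
  first
  | (exfalso; revert hn; decide)
  | (simp (decide := true) only [I3, X3, if_true, if_false,
      Int.cast_zero, Int.cast_one, Int.cast_neg, mul_zero, zero_mul, mul_one, add_zero, zero_add, sub_zero]; ring)

set_option maxHeartbeats 4000000 in
lemma valG (n : ℤ) (hn : (n : ZMod 3) = 1) : Ks n fG = Ds n (fun d e => (d * e - 1) / 3 * c3 d) := by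
  rw [tieG n hn, Ts_eval]
  refine Ds_sym fun d e hd he h => ?_
  rw [← h] at hn
  push_cast at hn
  obtain ⟨k, rfl | rfl | rfl⟩ := mod3 d <;> obtain ⟨l, rfl | rfl | rfl⟩ := mod3 e <;>
  push_cast [three0, zero_mul, zero_add] at hn <;>
  first
  | (exfalso; revert hn; decide)
  | (clear hn
     (first | rw [tri_0 _ k hd] | rw [tri_1 _ k hd] | rw [tri_2 _ k hd]) <;>
     (first | rw [tri_0 _ l he] | rw [tri_1 _ l he] | rw [tri_2 _ l he] | skip) <;>
     simp only [Quad, triV] <;>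
     (try intro m) <;>
     simp only [i3, c3] <;>
     push_cast <;>
     simp (decide := true) only [three0, I3, X3, if_true, if_false,
      Int.cast_zero, Int.cast_one, Int.cast_neg, mul_zero, zero_mul, mul_one, add_zero, zero_add, sub_zero] <;>
     ring)

set_option maxHeartbeats 4000000 in
lemma tieA (n : ℤ) (hn : (n : ZMod 3) = 1) :
    Ts n (fun A x d => gA A d x d - gA d A x d) =
    Ts n (fun A x d => 18 * g0 A d x d - (4 * ff x + ff (x + d))) := by
  refine Ts_sym fun A x d _ _ _ h => ?_
  simp only [ff, gA, g0, i3, c3]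
  rw [← h] at hn
  push_cast at hn ⊢
  generalize (d : ZMod 3) = d0 at *
  generalize (A : ZMod 3) = A0 at *
  generalize (x : ZMod 3) = x0 at *
  rcases z3cases d0 with rfl | rfl | rfl <;> rcases z3cases A0 with rfl | rfl | rfl <;>
  rcases z3cases x0 with rfl | rfl | rfl <;>
  first
  | (exfalso; revert hn; decide)
  | (simp (decide := true) only [I3, X3, if_true, if_false,
      Int.cast_zero, Int.cast_one, Int.cast_neg, mul_zero, zero_mul, mul_one, add_zero, zero_add, sub_zero]; ring)

set_option maxHeartbeats 4000000 in
lemma tieB (n : ℤ) (hn : (n : ZMod 3) = 2) :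
    Ts n (fun A x d => gB A d x d - gB d A x d) =
    Ts n (fun A x d => i3 A * (-4*A*A - 4*A*x + 10/3*A*d + 25/3*d*d - 13/3*x*x + 4*x*d)
      + i3 (A - d) * (-8/3*A*A - 2*A*x + 4/3*A*d + 10/3*d*d)) := by
  refine Ts_sym fun A x d _ _ _ h => ?_
  simp only [gB, i3, c3]
  rw [← h] at hn
  push_cast at hn ⊢
  generalize (d : ZMod 3) = d0 at *
  generalize (A : ZMod 3) = A0 at *
  generalize (x : ZMod 3) = x0 at *
  rcases z3cases d0 with rfl | rfl | rfl <;> rcases z3cases A0 with rfl | rfl | rfl <;>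
  rcases z3cases x0 with rfl | rfl | rfl <;>
  first
  | (exfalso; revert hn; decide)
  | (simp (decide := true) only [I3, X3, if_true, if_false,
      Int.cast_zero, Int.cast_one, Int.cast_neg, mul_zero, zero_mul, mul_one, add_zero, zero_add, sub_zero]; ring)



set_option maxHeartbeats 2000000 in
lemma ptwise (t p q r : ℤ) (c : ℚ) (ht : 0 < t) (h1 : ¬ (p = 0 ∧ q = 0)) (h2 : ¬ (p = 0 ∧ r = 0))
    (h3 : ¬ (q = 0 ∧ r = 0)) :
    (if (-t < r ∧ r < t ∧ 0 < p + r ∧ 0 < q + r) ∧ 0 < r then c else 0) +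
    (if t < r ∧ -t < p ∧ -t < q ∧ 0 < p + q then c else 0) +
    (if t = r ∧ -t < p ∧ -t < q ∧ 0 < p + q then c else 0) =
    (if 0 < p ∧ 0 < q ∧ 0 < r then c else 0) +
    (if p = 0 ∧ 0 < q ∧ 0 < r then c else 0) +
    (if q = 0 ∧ 0 < p ∧ 0 < r then c else 0) +
    (if (-t < p ∧ p < t ∧ 0 < q + p ∧ 0 < r + p) ∧ p < 0 then c else 0) +
    (if (-t < q ∧ q < t ∧ 0 < p + q ∧ 0 < r + q) ∧ q < 0 then c else 0) +
    (if r < t ∧ p + q < 0 ∧ 0 < p + r ∧ 0 < q + r then c else 0) +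
    (if p + q = 0 ∧ -r < p ∧ p < r ∧ r < t ∧ p ≠ 0 then c else 0) := by
  have key : ∀ (a b d e f g h i j k : Prop) [Decidable a] [Decidable b] [Decidable d] [Decidable e] [Decidable f] [Decidable g] [Decidable h] [Decidable i] [Decidable j] [Decidable k], 
    ((if a then 1 else 0) + (if b then 1 else 0) + (if d then 1 else 0) : ℤ) =
    (if e then 1 else 0) + (if f then 1 else 0) + (if g then 1 else 0)+(if h then 1 else 0)+(if i then 1 else 0)+(if j then 1 else 0)+(if k then 1 else 0) → 
    ((if a then c else 0) + (if b then c else 0) + (if d then c else 0) : ℚ) =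
    (if e then c else 0) + (if f then c else 0) + (if g then c else 0)+(if h then c else 0)+(if i then c else 0)+(if j then c else 0)+(if k then c else 0) := by
    intro a b d e f g h i j k _ _ _ _ _ _ _ _ _ _ H
    have H' := congrArg (fun z : ℤ => (z : ℚ) * c) H
    push_cast at H'
    simpa [add_mul, ite_mul] using H'
  apply key
  clear key
  grind (splits := 40)


/-- ambient set -/
noncomputable def Am (n : ℤ) : Finset (ℤ × ℤ × ℤ × ℤ) :=
  ((Finset.Icc 1 (10 * n)) ×ˢ (Finset.Icc (-(10 * n)) (10 * n)) ×ˢ (Finset.Icc (-(10 * n)) (10 * n)) ×ˢ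
    (Finset.Icc (-(10 * n)) (10 * n))).filter
    (fun v => ((v.1 - v.2.1) % 2 = 0 ∧ (v.1 - v.2.2.1) % 2 = 0 ∧ (v.1 - v.2.2.2) % 2 = 0) ∧
      v.1 ^ 2 + v.2.1 * v.2.2.1 + v.2.2.1 * v.2.2.2 + v.2.2.2 * v.2.1 = 4 * n)

/-- sums over the ambient set -/
noncomputable def As (n : ℤ) (g : F4) : ℚ := ∑ v ∈ Am n, g v.1 v.2.1 v.2.2.1 v.2.2.2

lemma mem_Am {n t p q r : ℤ} : (t, p, q, r) ∈ Am n ↔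
    ((1 ≤ t ∧ t ≤ 10 * n) ∧ (-(10 * n) ≤ p ∧ p ≤ 10 * n) ∧ (-(10 * n) ≤ q ∧ q ≤ 10 * n) ∧
     (-(10 * n) ≤ r ∧ r ≤ 10 * n)) ∧ ((t - p) % 2 = 0 ∧ (t - q) % 2 = 0 ∧ (t - r) % 2 = 0) ∧
     t ^ 2 + p * q + q * r + r * p = 4 * n := by
  simp only [Am, Finset.mem_filter, Finset.mem_product, Finset.mem_Icc]

lemma As_add (n : ℤ) (g h : F4) : As n (fun A D x y => g A D x y + h A D x y) = As n g + As n h :=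
  Finset.sum_add_distrib

lemma As_pq (n : ℤ) (g : F4) : As n g = As n (fun t p q r => g t q p r) := by
  refine Finset.sum_nbij' (fun v => (v.1, v.2.2.1, v.2.1, v.2.2.2))
    (fun v => (v.1, v.2.2.1, v.2.1, v.2.2.2)) ?_ ?_ ?_ ?_ ?_ <;> rintro ⟨t, p, q, r⟩
  · simp only [mem_Am]; rintro ⟨⟨h1, h2, h3, h4⟩, ⟨h5, h6, h7⟩, h8⟩
    exact ⟨⟨h1, h3, h2, h4⟩, ⟨h6, h5, h7⟩, by linarith⟩
  · simp only [mem_Am]; rintro ⟨⟨h1, h2, h3, h4⟩, ⟨h5, h6, h7⟩, h8⟩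
    exact ⟨⟨h1, h3, h2, h4⟩, ⟨h6, h5, h7⟩, by linarith⟩
  · simp
  · simp
  · simp

lemma As_pr (n : ℤ) (g : F4) : As n g = As n (fun t p q r => g t r q p) := by
  refine Finset.sum_nbij' (fun v => (v.1, v.2.2.2, v.2.2.1, v.2.1))
    (fun v => (v.1, v.2.2.2, v.2.2.1, v.2.1)) ?_ ?_ ?_ ?_ ?_ <;> rintro ⟨t, p, q, r⟩
  · simp only [mem_Am]; rintro ⟨⟨h1, h2, h3, h4⟩, ⟨h5, h6, h7⟩, h8⟩
    exact ⟨⟨h1, h4, h3, h2⟩, ⟨h7, h6, h5⟩, by linarith⟩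
  · simp only [mem_Am]; rintro ⟨⟨h1, h2, h3, h4⟩, ⟨h5, h6, h7⟩, h8⟩
    exact ⟨⟨h1, h4, h3, h2⟩, ⟨h7, h6, h5⟩, by linarith⟩
  · simp
  · simp
  · simp

lemma As_K (n : ℤ) (g : F4) : As n (fun t p q r => if -t < r ∧ r < t ∧ 0 < p + r ∧ 0 < q + r then
      g t p q r else 0) =
    Ks n (fun A D x y => g (A + D) (2 * x - (A - D)) (2 * y - (A - D)) (A - D)) := by
  unfold As
  rw [← Finset.sum_filter]
  refine Finset.sum_nbij' (fun v => ((v.1 + v.2.2.2) / 2, (v.1 - v.2.2.2) / 2,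
      (v.2.1 + v.2.2.2) / 2, (v.2.2.1 + v.2.2.2) / 2))
    (fun v => (v.1 + v.2.1, 2 * v.2.2.1 - (v.1 - v.2.1), 2 * v.2.2.2 - (v.1 - v.2.1), v.1 - v.2.1))
     ?_ ?_ ?_ ?_ ?_
  · rintro ⟨t, p, q, r⟩
    simp only [Finset.mem_filter, mem_Am, mem_K]
    rintro ⟨⟨⟨h0, -⟩, ⟨h5, h6, h7⟩, h8⟩, h9⟩
    obtain ⟨A, hA⟩ : ∃ A, t + r = 2 * A := ⟨(t + r) / 2, by omega⟩
    obtain ⟨x, hx⟩ : ∃ A, p + r = 2 * A := ⟨(p + r) / 2, by omega⟩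
    obtain ⟨y, hy⟩ : ∃ A, q + r = 2 * A := ⟨(q + r) / 2, by omega⟩
    obtain rfl : t = 2 * A - r := by omega
    obtain rfl : p = 2 * x - r := by omega
    obtain rfl : q = 2 * y - r := by omega
    rw [hA, hx, hy, show 2 * A - r - r = 2 * (A - r) by ring]
    simp only [Int.mul_ediv_cancel_left _ (two_ne_zero)]
    exact ⟨by omega, by omega, by omega, by omega, by linarith⟩
  · rintro ⟨A, D, x, y⟩ hv
    have hv' := hv
    simp only [Kset, Finset.mem_filter, Finset.mem_product, Finset.mem_Icc] at hv'
    simp only [Finset.mem_filter, mem_Am]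
    exact ⟨⟨by omega, by omega, by linarith [hv'.2]⟩, by omega⟩
  · rintro ⟨t, p, q, r⟩
    simp only [Finset.mem_filter, mem_Am, Prod.mk.injEq]
    rintro ⟨⟨⟨h0, -⟩, ⟨h5, h6, h7⟩, h8⟩, h9⟩
    omega
  · rintro ⟨A, D, x, y⟩ hv
    simp only [Prod.mk.injEq]
    omega
  · rintro ⟨t, p, q, r⟩
    simp only [Finset.mem_filter, mem_Am, Prod.mk.injEq]
    rintro ⟨⟨⟨h0, -⟩, ⟨h5, h6, h7⟩, h8⟩, h9⟩
    congr <;> omega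

lemma As_O (n : ℤ) (f : ℤ → ℚ) : As n (fun t p q r => if t < r ∧ -t < p ∧ -t < q ∧ 0 < p + q then
      f t else 0) =
    Ks n (fun A D x y => if D < x + y then f (x + y - D) else 0) := by
  unfold As Ks
  rw [← Finset.sum_filter, ← Finset.sum_filter]
  refine Finset.sum_nbij' (fun v => ((v.2.2.2 - v.1) / 2, (v.2.1 + v.2.2.1) / 2,
      (v.2.1 + v.1) / 2, (v.2.2.1 + v.1) / 2))
    (fun v => (v.2.2.1 + v.2.2.2 - v.2.1, v.2.2.1 - v.2.2.2 + v.2.1,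
      v.2.2.2 - v.2.2.1 + v.2.1, 2 * v.1 + (v.2.2.1 + v.2.2.2 - v.2.1)))
     ?_ ?_ ?_ ?_ ?_
  · rintro ⟨t, p, q, r⟩
    simp only [Finset.mem_filter, mem_Am, mem_K]
    rintro ⟨⟨⟨h0, -⟩, ⟨h5, h6, h7⟩, h8⟩, h9⟩
    obtain ⟨A, hA⟩ : ∃ A, r - t = 2 * A := ⟨(r - t) / 2, by omega⟩
    obtain ⟨x, hx⟩ : ∃ A, p + t = 2 * A := ⟨(p + t) / 2, by omega⟩
    obtain ⟨y, hy⟩ : ∃ A, q + t = 2 * A := ⟨(q + t) / 2, by omega⟩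
    obtain rfl : r = 2 * A + t := by omega
    obtain rfl : p = 2 * x - t := by omega
    obtain rfl : q = 2 * y - t := by omega
    rw [hA, hx, hy, show 2 * x - t + (2 * y - t) = 2 * (x + y - t) by ring]
    simp only [Int.mul_ediv_cancel_left _ (two_ne_zero)]
    exact ⟨⟨by omega, by omega, by omega, by omega, by linarith⟩, by omega⟩
  · rintro ⟨A, D, x, y⟩ hv
    have hv' := hv
    simp only [Kset, Finset.mem_filter, Finset.mem_product, Finset.mem_Icc] at hv'
    simp only [Finset.mem_filter, mem_Am]
    exact ⟨⟨by omega, by omega, by linarith [hv'.1.2]⟩, by omega⟩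
  · rintro ⟨t, p, q, r⟩
    simp only [Finset.mem_filter, mem_Am, Prod.mk.injEq]
    rintro ⟨⟨⟨h0, -⟩, ⟨h5, h6, h7⟩, h8⟩, h9⟩
    omega
  · rintro ⟨A, D, x, y⟩ hv
    simp only [Prod.mk.injEq]
    omega
  · rintro ⟨t, p, q, r⟩
    simp only [Finset.mem_filter, mem_Am, Prod.mk.injEq]
    rintro ⟨⟨⟨h0, -⟩, ⟨h5, h6, h7⟩, h8⟩, h9⟩
    congr; omega

lemma As_B (n : ℤ) (f : ℤ → ℚ) :
    As n (fun t p q r => if r < t ∧ p + q < 0 ∧ 0 < p + r ∧ 0 < q + r then f t else 0) =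
    Ks n (fun A D x y => if A < x ∧ A < y then f (x + y + D) else 0) := by
  unfold As Ks
  rw [← Finset.sum_filter, ← Finset.sum_filter]
  refine Finset.sum_nbij' (fun v => ((v.1 - v.2.2.2) / 2, (-(v.2.1 + v.2.2.1)) / 2,
      (v.2.1 + v.1) / 2, (v.2.2.1 + v.1) / 2))
    (fun v => (v.2.2.1 + v.2.2.2 + v.2.1, v.2.2.1 - v.2.2.2 - v.2.1,
      v.2.2.2 - v.2.2.1 - v.2.1, (v.2.2.1 + v.2.2.2 + v.2.1) - 2 * v.1))
     ?_ ?_ ?_ ?_ ?_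
  · rintro ⟨t, p, q, r⟩
    simp only [Finset.mem_filter, mem_Am, mem_K]
    rintro ⟨⟨⟨h0, -⟩, ⟨h5, h6, h7⟩, h8⟩, h9⟩
    obtain ⟨A, hA⟩ : ∃ A, t - r = 2 * A := ⟨(t - r) / 2, by omega⟩
    obtain ⟨x, hx⟩ : ∃ A, p + t = 2 * A := ⟨(p + t) / 2, by omega⟩
    obtain ⟨y, hy⟩ : ∃ A, q + t = 2 * A := ⟨(q + t) / 2, by omega⟩
    obtain rfl : r = t - 2 * A := by omega
    obtain rfl : p = 2 * x - t := by omega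
    obtain rfl : q = 2 * y - t := by omega
    rw [hA, hx, hy, show -(2 * x - t + (2 * y - t)) = 2 * (t - x - y) by ring]
    simp only [Int.mul_ediv_cancel_left _ (two_ne_zero)]
    exact ⟨⟨by omega, by omega, by omega, by omega, by linarith⟩, by omega⟩
  · rintro ⟨A, D, x, y⟩ hv
    have hv' := hv
    simp only [Kset, Finset.mem_filter, Finset.mem_product, Finset.mem_Icc] at hv'
    simp only [Finset.mem_filter, mem_Am]
    exact ⟨⟨by omega, by omega, by linarith [hv'.1.2]⟩, by omega⟩
  · rintro ⟨t, p, q, r⟩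
    simp only [Finset.mem_filter, mem_Am, Prod.mk.injEq]
    rintro ⟨⟨⟨h0, -⟩, ⟨h5, h6, h7⟩, h8⟩, h9⟩
    omega
  · rintro ⟨A, D, x, y⟩ hv
    simp only [Prod.mk.injEq]
    omega
  · rintro ⟨t, p, q, r⟩
    simp only [Finset.mem_filter, mem_Am, Prod.mk.injEq]
    rintro ⟨⟨⟨h0, -⟩, ⟨h5, h6, h7⟩, h8⟩, h9⟩
    congr; omega

lemma As_V (n : ℤ) (f : ℤ → ℚ) :
    As n (fun t p q r => if t = r ∧ -t < p ∧ -t < q ∧ 0 < p + q then f t else 0) =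
    Ds n (fun d e => ∑ t ∈ Finset.Ioo 0 (d + e), f t) := by
  unfold As Ds
  rw [← Finset.sum_filter, Finset.sum_sigma']
  refine Finset.sum_nbij' (fun v => ⟨((v.2.1 + v.1) / 2, (v.2.2.1 + v.1) / 2), v.1⟩)
    (fun w => (w.2, 2 * w.1.1 - w.2, 2 * w.1.2 - w.2, w.2))
     ?_ ?_ ?_ ?_ ?_
  · rintro ⟨t, p, q, r⟩
    simp only [Finset.mem_filter, mem_Am, mem_D, Finset.mem_sigma, Finset.mem_Ioo]
    rintro ⟨⟨⟨h0, -⟩, ⟨h5, h6, h7⟩, h8⟩, rfl, h9⟩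
    obtain ⟨x, hx⟩ : ∃ A, p + t = 2 * A := ⟨(p + t) / 2, by omega⟩
    obtain ⟨y, hy⟩ : ∃ A, q + t = 2 * A := ⟨(q + t) / 2, by omega⟩
    obtain rfl : p = 2 * x - t := by omega
    obtain rfl : q = 2 * y - t := by omega
    rw [hx, hy]
    simp only [Int.mul_ediv_cancel_left _ (two_ne_zero)]
    exact ⟨⟨by omega, by omega, by linarith⟩, by omega⟩
  · rintro ⟨⟨d, e⟩, t⟩ hv
    simp only [Dset, Finset.mem_filter, Finset.mem_product, Finset.mem_Icc, Finset.mem_sigma,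
      Finset.mem_Ioo] at hv
    simp only [Finset.mem_filter, mem_Am]
    exact ⟨⟨by omega, by omega, by linarith [hv.1.2]⟩, trivial, by omega⟩
  · rintro ⟨t, p, q, r⟩
    simp only [Finset.mem_filter, mem_Am, Prod.mk.injEq]
    rintro ⟨⟨⟨h0, -⟩, ⟨h5, h6, h7⟩, h8⟩, h9⟩
    refine ⟨trivial, ?_⟩; omega
  · rintro ⟨⟨d, e⟩, t⟩ hv
    simp
  · rintro ⟨t, p, q, r⟩
    simp

lemma As_U (n : ℤ) (f : ℤ → ℚ) (hf : ∀ d : ℤ, d * d = n → f (d + d) = 0) :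
    As n (fun t p q r => if p + q = 0 ∧ -r < p ∧ p < r ∧ r < t ∧ p ≠ 0 then f t else 0) =
    Ds n (fun d e => (min d e - 1 : ℤ) * f (d + e)) := by
  have e1 : Ds n (fun d e => (min d e - 1 : ℤ) * f (d + e)) =
     Ds n (fun d e => ∑ j ∈ Finset.Ioo 0 (min d e), if d = e then 0 else f (d + e)) := by
    refine Ds_congr ?_
    intro d e hd he hde
    rw [Finset.sum_const, Int.card_Ioo]
    split_ifs with h
    · subst h; rw [hf d hde]; simp
    · rw [nsmul_eq_mul]
      congr 1
      have : 0 ≤ min d e - 1 := by omega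
      rw [sub_zero, ← Int.cast_natCast, Int.toNat_of_nonneg this]
  rw [e1]
  unfold As Ds
  rw [← Finset.sum_filter, Finset.sum_sigma']
  rw [← Finset.sum_filter_of_ne (p := fun w : Sigma (fun _ : ℤ × ℤ => ℤ) => w.1.1 ≠ w.1.2)
    (by intro w _ h h'; apply h; simp [h'])]
  refine Finset.sum_nbij' (fun v => ⟨((v.1 + v.2.1) / 2, (v.1 - v.2.1) / 2), (v.1 - v.2.2.2) / 2⟩)
    (fun w => (w.1.1 + w.1.2, w.1.1 - w.1.2, w.1.2 - w.1.1, w.1.1 + w.1.2 - 2 * w.2))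
     ?_ ?_ ?_ ?_ ?_
  · rintro ⟨t, p, q, r⟩
    simp only [Finset.mem_filter, mem_Am, mem_D, Finset.mem_sigma, Finset.mem_Ioo]
    rintro ⟨⟨⟨h0, -⟩, ⟨h5, h6, h7⟩, h8⟩, h9, h10⟩
    obtain rfl : q = - p := by omega
    obtain ⟨x, hx⟩ : ∃ A, t + p = 2 * A := ⟨(t + p) / 2, by omega⟩
    obtain ⟨y, hy⟩ : ∃ A, t - p = 2 * A := ⟨(t - p) / 2, by omega⟩
    obtain rfl : p = x - y := by omega
    obtain rfl : t = x + y := by omega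
    rw [hx, hy]
    simp only [Int.mul_ediv_cancel_left _ (two_ne_zero)]
    exact ⟨⟨⟨by omega, by omega, by linarith⟩, by omega⟩, by omega⟩
  · rintro ⟨⟨d, e⟩, t⟩ hv
    simp only [Dset, Finset.mem_filter, Finset.mem_product, Finset.mem_Icc, Finset.mem_sigma,
      Finset.mem_Ioo] at hv
    simp only [Finset.mem_filter, mem_Am]
    exact ⟨⟨by omega, by omega, by linarith [hv.1.1.2]⟩, by omega⟩
  · rintro ⟨t, p, q, r⟩
    simp only [Finset.mem_filter, mem_Am, Prod.mk.injEq]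
    rintro ⟨⟨⟨h0, -⟩, ⟨h5, h6, h7⟩, h8⟩, h9⟩
    omega
  · rintro ⟨⟨d, e⟩, t⟩ hv
    simp only [Finset.mem_filter] at hv
    simp only [Sigma.mk.injEq, Prod.mk.injEq, heq_eq_eq]
    omega
  · rintro ⟨t, p, q, r⟩
    simp only [Finset.mem_filter, mem_Am, Prod.mk.injEq]
    rintro ⟨⟨⟨h0, -⟩, ⟨h5, h6, h7⟩, h8⟩, h9⟩
    rw [if_neg (by omega)]
    congr; omega

/-- weighted sum over reduced triples -/
noncomputable def TW (n : ℤ) (f : ℤ → ℚ) : ℚ :=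
  As n (fun t p q r => if 0 < p ∧ 0 < q ∧ 0 < r then f t else 0) +
  3 / 2 * As n (fun t p q r => if r = 0 ∧ 0 < p ∧ 0 < q then f t else 0)

lemma star (n : ℤ) (f : ℤ → ℚ) (hf : ∀ d : ℤ, d * d = n → f (d + d) = 0)
    (hf2 : ∀ d : ℤ, d * d = 4 * n → f d = 0) :
    TW n f = Ks n (fun A D x y => if D < x + y then f (x + y - D) else 0)
      + Ds n (fun d e => ∑ t ∈ Finset.Ioo 0 (d + e), f t)
      - Ks n (fun A D x y => if A < x ∧ A < y then f (x + y + D) else 0)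
      - Ds n (fun d e => (min d e - 1 : ℤ) * f (d + e))
      - 1 / 2 * Ks n (fun A D x y => f (A + D)) := by
  have H : As n (fun t p q r => (if (-t < r ∧ r < t ∧ 0 < p + r ∧ 0 < q + r) ∧ 0 < r then f t else 0) +
    (if t < r ∧ -t < p ∧ -t < q ∧ 0 < p + q then f t else 0) +
    (if t = r ∧ -t < p ∧ -t < q ∧ 0 < p + q then f t else 0)) =
    As n (fun t p q r => (if 0 < p ∧ 0 < q ∧ 0 < r then f t else 0) +
    (if p = 0 ∧ 0 < q ∧ 0 < r then f t else 0) +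
    (if q = 0 ∧ 0 < p ∧ 0 < r then f t else 0) +
    (if (-t < p ∧ p < t ∧ 0 < q + p ∧ 0 < r + p) ∧ p < 0 then f t else 0) +
    (if (-t < q ∧ q < t ∧ 0 < p + q ∧ 0 < r + q) ∧ q < 0 then f t else 0) +
    (if r < t ∧ p + q < 0 ∧ 0 < p + r ∧ 0 < q + r then f t else 0) +
    (if p + q = 0 ∧ -r < p ∧ p < r ∧ r < t ∧ p ≠ 0 then f t else 0)) := by
    refine Finset.sum_congr rfl ?_
    rintro ⟨t, p, q, r⟩ hv
    obtain ⟨⟨h1, -⟩, -, h8⟩ := mem_Am.1 hv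
    by_cases h0 : f t = 0
    · simp [h0]
    · have h4 : t * t ≠ 4 * n := fun h => h0 (hf2 t h)
      apply ptwise t p q r (f t) (by omega)
      · rintro ⟨rfl, rfl⟩; apply h4; linarith
      · rintro ⟨rfl, rfl⟩; apply h4; linarith
      · rintro ⟨rfl, rfl⟩; apply h4; linarith
  simp only [As_add] at H
  rw [As_O, As_V, As_B, As_U n f hf] at H
  have k1 : As n (fun t p q r => if (-t < r ∧ r < t ∧ 0 < p + r ∧ 0 < q + r) ∧ 0 < r then f t else 0)
    = Ks n (fun A D x y => if D < A then f (A + D) else 0) := by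
    simp only [ite_and]
    simp only [← ite_and]
    have := As_K n (fun t p q r => if 0 < r then f t else 0)
    simp only [sub_pos] at this
    rw [← this]
    simp only [← ite_and]; simp only [and_assoc]
  have k2 : As n (fun t p q r => if (-t < r ∧ r < t ∧ 0 < p + r ∧ 0 < q + r) ∧ r < 0 then f t else 0)
    = Ks n (fun A D x y => if A < D then f (A + D) else 0) := by
    have := As_K n (fun t p q r => if r < 0 then f t else 0)
    simp only [sub_neg] at this
    rw [← this]
    simp only [← ite_and]
  have k3 : As n (fun t p q r => if r = 0 ∧ 0 < p ∧ 0 < q then f t else 0)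
    = Ks n (fun A D x y => if A = D then f (A + D) else 0) := by
    have := As_K n (fun t p q r => if r = 0 then f t else 0)
    simp only [sub_eq_zero] at this
    rw [← this]
    refine Finset.sum_congr rfl ?_
    rintro ⟨t, p, q, r⟩ hv
    obtain ⟨⟨h1, -⟩, -, h8⟩ := mem_Am.1 hv
    simp only [← ite_and]
    refine if_congr ?_ rfl rfl
    constructor
    · rintro ⟨rfl, h2, h3⟩; omega
    · rintro ⟨h2, rfl⟩; omega
  have k4 : Ks n (fun A D x y => if A < D then f (A + D) else 0) =
      Ks n (fun A D x y => if D < A then f (A + D) else 0) := by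
    rw [Ks_alpha]; simp only [add_comm]
  have k5 : Ks n (fun A D x y => f (A + D)) = Ks n (fun A D x y => if A < D then f (A + D) else 0) +
      Ks n (fun A D x y => if A = D then f (A + D) else 0) +
      Ks n (fun A D x y => if D < A then f (A + D) else 0) := by
    rw [← Ks_add, ← Ks_add]
    refine Ks_congr ?_
    intro A D x y _ _ _ _ _
    rcases lt_trichotomy A D with h | h | h
    · simp [h, h.ne, h.not_gt]
    · simp [h]
    · simp [h, h.ne', h.not_gt]
  have k6 : As n (fun t p q r => if (-t < p ∧ p < t ∧ 0 < q + p ∧ 0 < r + p) ∧ p < 0 then f t else 0)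
    = As n (fun t p q r => if (-t < r ∧ r < t ∧ 0 < p + r ∧ 0 < q + r) ∧ r < 0 then f t else 0) := by
    rw [As_pr, As_pq]
  have k7 : As n (fun t p q r => if (-t < q ∧ q < t ∧ 0 < p + q ∧ 0 < r + q) ∧ q < 0 then f t else 0)
    = As n (fun t p q r => if (-t < r ∧ r < t ∧ 0 < p + r ∧ 0 < q + r) ∧ r < 0 then f t else 0) := by
    rw [As_pq, ← k6]
  have k8 : As n (fun t p q r => if p = 0 ∧ 0 < q ∧ 0 < r then f t else 0)
    = As n (fun t p q r => if r = 0 ∧ 0 < p ∧ 0 < q then f t else 0) := by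
    rw [As_pr]
    congr 1; ext t p q r
    refine if_congr ?_ rfl rfl
    constructor <;> intro h <;> omega
  have k9 : As n (fun t p q r => if q = 0 ∧ 0 < p ∧ 0 < r then f t else 0)
    = As n (fun t p q r => if r = 0 ∧ 0 < p ∧ 0 < q then f t else 0) := by
    rw [As_pq, k8]
  rw [k1, k6, k7, k8, k9, k2, k3, k4] at H
  unfold TW
  rw [k3, k5, k4]
  linarith


lemma step2 (n : ℤ) (f : ℤ → ℚ) (he : ∀ t, f (-t) = f t) (h0 : f 0 = 0) :
    Ks n (fun A D x y => if D < x + y then f (x + y - D) else 0) =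
    Ps n (fun z A y x => f (x + y)) + Ts n (fun A x d => f x) +
      1 / 2 * Ps n (fun z A y x => f (x - z)) := by
  rw [Ks_main, Ps_add]
  have e1 : Ps n (fun z A y x => if y < A + (y + z) then f (A + (y + z) - y) else 0) =
      Ps n (fun z A y x => f (x + y)) := by
    rw [Ps_rev n (fun z A y x => f (x + y))]
    refine Ps_congr fun z A y x _ _ _ _ _ => ?_
    rw [if_pos (by omega)]; congr 1; ring
  have e2 : Ts n (fun A x d => if d < x + d then f (x + d - d) else 0) = Ts n (fun A x d => f x) := by
    refine Ts_congr fun A x d _ _ _ _ => ?_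
    rw [if_pos (by omega)]; congr 1; ring
  have e3 : Ps n (fun z A y x => f (x - z)) =
      Ps n (fun z A y x => if y + z < x + y then f (x + y - (y + z)) else 0) +
      Ps n (fun z A y x => if y + z < x + y then f (x + y - (y + z)) else 0) := by
    nth_rewrite 3 [Ps_rev]
    rw [← Ps_add]
    refine Ps_congr fun z A y x _ _ _ _ _ => ?_
    rcases lt_trichotomy x z with h | h | h
    · rw [if_neg (by omega), if_pos (by omega), ← he, zero_add]; congr 1; ring
    · rw [if_neg (by omega), if_neg (by omega), h, sub_self, h0]; simp
    · rw [if_pos (by omega), if_neg (by omega), add_zero]; congr 1; ring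
  rw [e1, e2, e3]
  ring

lemma tieE (n : ℤ) (f : ℤ → ℚ) :
    Ps n (fun z A y x => if A = y then f (z + A + y + x) else 0) =
    Ds n (fun d e => if d < e then (e - d - 1 : ℤ) * f (d + e) else 0) := by
  have e1 : Ds n (fun d e => if d < e then (e - d - 1 : ℤ) * f (d + e) else 0) =
     Ds n (fun d e => ∑ j ∈ Finset.Ioo 0 (e - d), f (d + e)) := by
    refine Ds_congr ?_
    intro d e hd he hde
    rw [Finset.sum_const, Int.card_Ioo]
    split_ifs with h
    · rw [nsmul_eq_mul]
      congr 1
      have : 0 ≤ e - d - 1 := by omega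
      rw [sub_zero, ← Int.cast_natCast, Int.toNat_of_nonneg this]
    · rw [Int.toNat_of_nonpos (by omega)]; simp
  rw [e1]
  unfold Ps Ds
  rw [← Finset.sum_filter, Finset.sum_sigma']
  refine Finset.sum_nbij' (fun v => ⟨(v.2.1, v.1 + v.2.1 + v.2.2.2), v.1⟩)
    (fun w => (w.2, w.1.1, w.1.1, w.1.2 - w.1.1 - w.2)) ?_ ?_ ?_ ?_ ?_
  · rintro ⟨z, A, y, x⟩
    simp only [Finset.mem_filter, Finset.mem_sigma, mem_D, mem_P, Finset.mem_Ioo]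
    rintro ⟨⟨h1, h2, h3, h4, h5⟩, rfl⟩
    exact ⟨⟨h2, by omega, by linarith⟩, h1, by omega⟩
  · rintro ⟨⟨d, e⟩, z⟩
    simp only [Finset.mem_filter, Finset.mem_sigma, mem_D, mem_P, Finset.mem_Ioo]
    rintro ⟨⟨h1, h2, h3⟩, h4, h5⟩
    exact ⟨⟨h4, h1, h1, by omega, by linarith⟩, trivial⟩
  · rintro ⟨z, A, y, x⟩
    simp only [Finset.mem_filter, Prod.mk.injEq]
    rintro ⟨-, rfl⟩
    refine ⟨trivial, trivial, rfl, ?_⟩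
    ring
  · rintro ⟨⟨d, e⟩, z⟩ _
    simp only [Sigma.mk.injEq, Prod.mk.injEq, heq_eq_eq]
    refine ⟨⟨trivial, ?_⟩, trivial⟩
    ring
  · rintro ⟨z, A, y, x⟩
    simp only [Finset.mem_filter]
    rintro ⟨-, rfl⟩
    congr 1; ring

lemma step3 (n : ℤ) (f : ℤ → ℚ) :
    Ks n (fun A D x y => if A < x ∧ A < y then f (x + y + D) else 0) =
    1 / 2 * Ps n (fun z A y x => f (z + A + y + x)) -
    1 / 2 * Ps n (fun z A y x => if A = y then f (z + A + y + x) else 0) := by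
  rw [Ks_swap, Ks_beta]
  have e1 : Ks n (fun A D x y => if y < A ∧ y < D then f (A + D + x) else 0) =
      Ps n (fun z A y x => if y < A then f (z + A + y + x) else 0) := by
    have := Ks_gt n (fun A D x y => if y < A then f (A + D + x) else 0)
    have h2 : Ps n (fun z A y x => if y < A then f (z + A + y + x) else 0) =
      Ps n (fun z A y x => if y < A then f (A + (y + z) + x) else 0) := by
      refine Ps_congr fun z A y x _ _ _ _ _ => ?_
      congr 2; ring
    rw [h2, ← this]
    refine Ks_congr fun A D x y _ _ _ _ _ => ?_
    rw [← ite_and]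
    simp only [and_comm]
  have e2 : Ps n (fun z A y x => f (z + A + y + x)) =
      Ps n (fun z A y x => if y < A then f (z + A + y + x) else 0) +
      Ps n (fun z A y x => if y < A then f (z + A + y + x) else 0) +
      Ps n (fun z A y x => if A = y then f (z + A + y + x) else 0) := by
    nth_rewrite 3 [Ps_rev]
    rw [← Ps_add, ← Ps_add]
    refine Ps_congr fun z A y x _ _ _ _ _ => ?_
    have : x + y + A + z = z + A + y + x := by ring
    rw [this]
    rcases lt_trichotomy y A with h | h | h
    · simp [h, h.ne', h.not_gt]
    · simp [h]
    · simp [h, h.ne, h.not_gt]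
  rw [e1, e2]; ring

lemma Vsplit (n : ℤ) (f : ℤ → ℚ) (hd : ∀ d e : ℤ, d * e = n → f d = 0) :
    Ds n (fun d e => ∑ t ∈ Finset.Ioo 0 (d + e), f t) =
    Ts n (fun A x d => f x) + Ts n (fun A x d => f (x + d)) := by
  rw [Ts_rev n (fun A x d => f x), Ts_rev n (fun A x d => f (x + d)), Ts_eval, Ts_eval,
    Ds_rev n (fun d e => ∑ A ∈ Finset.Ioo 0 e, f A), ← Ds_add]
  refine Ds_congr fun d e h1 h2 h3 => ?_
  have e1 : ∑ A ∈ Finset.Ioo 0 e, f (A + d) = ∑ A ∈ Finset.Ioo d (d + e), f A := by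
    refine Finset.sum_nbij' (fun a => a + d) (fun a => a - d) ?_ ?_ ?_ ?_ ?_ <;>
    intro a <;> simp only [Finset.mem_Ioo] <;> intro h <;> grind
  have e2 : Finset.Ioo 0 (d + e) = insert d (Finset.Ioo 0 d ∪ Finset.Ioo d (d + e)) := by
    ext a; simp only [Finset.mem_Ioo, Finset.mem_insert, Finset.mem_union]; omega
  rw [e1, e2, Finset.sum_insert (by simp), hd d e h3, zero_add, Finset.sum_union]
  rw [Finset.disjoint_left]; intro a; simp only [Finset.mem_Ioo]; omega

lemma total (n : ℤ) (f : ℤ → ℚ) (he : ∀ t, f (-t) = f t) (h0 : f 0 = 0)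
    (hf : ∀ d : ℤ, d * d = n → f (d + d) = 0)
    (hf2 : ∀ d : ℤ, d * d = 4 * n → f d = 0) (hd : ∀ d e : ℤ, d * e = n → f d = 0) :
    2 * TW n f = Ps n (fun z A y x => f (x-z) + f (x+y) - f (z+A+y) - f (z+A+y+x)) +
      Ts n (fun A x d => 4 * f x + f (x + d)) +
      Ds n (fun d e => (if d < e then (e - d - 1 : ℤ) * f (d + e) else 0) -
        2 * ((min d e - 1 : ℤ) * f (d + e))) := by
  rw [star n f hf hf2, step2 n f he h0, step3, Vsplit n f hd, tieE, Ks_main n (fun A D x y => f (A + D))]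
  simp only [Ps_add, Ps_sub, Ts_add, Ds_sub, Ds_smul, Ts_smul]
  have e1 : Ts n (fun A x d => f (A + d)) = Ts n (fun A x d => f (x + d)) := Ts_rev n _
  have e2 : Ps n (fun z A y x => f (A + (y + z))) = Ps n (fun z A y x => f (z + A + y)) := by
    congr 1; ext z A y x; congr 1; ring
  rw [e1, e2]
  ring

lemma ff_even (t : ℤ) : ff (-t) = ff t := by
  unfold ff i3
  push_cast
  rcases z3cases (t : ZMod 3) with h | h | h <;> rw [h] <;> simp (decide := true) [I3]

lemma ff_zero : ff 0 = 0 := by simp [ff]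

lemma ff_eq0 (t : ℤ) (h : (t : ZMod 3) ≠ 0) : ff t = 0 := by
  unfold ff i3 I3
  rw [if_neg h]; simp

lemma ff_eq (t : ℤ) (h : (t : ZMod 3) = 0) : ff t = t ^ 2 := by
  unfold ff i3 I3
  rw [if_pos h]; simp

lemma total_ff (n : ℤ) (hn : (n : ZMod 3) ≠ 0) :
    2 * TW n ff = Ps n (fun z A y x => ff (x-z) + ff (x+y) - ff (z+A+y) - ff (z+A+y+x)) +
      Ts n (fun A x d => 4 * ff x + ff (x + d)) +
      Ds n (fun d e => (if d < e then (e - d - 1 : ℤ) * ff (d + e) else 0) -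
        2 * ((min d e - 1 : ℤ) * ff (d + e))) := by
  refine total n ff ff_even ff_zero ?_ ?_ ?_
  · intro d h; apply ff_eq0; intro h'; apply hn; rw [← h]; push_cast at h' ⊢
    revert h'; generalize (d : ZMod 3) = a; revert a; decide
  · intro d h; apply ff_eq0; intro h'; apply hn
    have := congrArg (fun z : ℤ => (z : ZMod 3)) h
    push_cast at this
    rw [h', show (4 : ZMod 3) = 1 by decide] at this
    simpa using this.symm
  · intro d e h; apply ff_eq0; intro h'; apply hn; rw [← h]; push_cast; rw [h']; simp

lemma caseA (n : ℤ) (hn : (n : ZMod 3) = 1) : TW n ff = 9 * Ks n g0 := by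
  have h1 := total_ff n (by rw [hn]; decide)
  have h2 : Ds n (fun d e => (if d < e then (e - d - 1 : ℤ) * ff (d + e) else 0) -
        2 * ((min d e - 1 : ℤ) * ff (d + e))) = 0 := by
    refine Finset.sum_eq_zero ?_
    rintro ⟨d, e⟩ h
    obtain ⟨-, -, h⟩ := mem_D.1 h
    have : ff (d + e) = 0 := by
      apply ff_eq0
      rw [← h] at hn; push_cast at hn ⊢
      generalize (d : ZMod 3) = a at *
      generalize (e : ZMod 3) = b at *
      revert a b; decide
    simp [this]
  have h3 := certA n hn
  rw [tieA n hn] at h3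
  have h4 := Ks_main n g0
  have e1 : Ps n (fun z A y x => ff (x-z) + ff (x+y) - ff (z+A+y) - ff (z+A+y+x)
      - 18 * (g0 A (y + z) x y + g0 x y A (y + z))) =
      Ps n (fun z A y x => ff (x-z) + ff (x+y) - ff (z+A+y) - ff (z+A+y+x)) -
      18 * Ps n (fun z A y x => g0 A (y + z) x y + g0 x y A (y + z)) := by
    rw [Ps_sub, Ps_smul]
  rw [e1, Ts_sub, Ts_smul] at h3
  rw [h2] at h1
  linarith

set_option maxHeartbeats 4000000 in
lemma valB (n : ℤ) (hn : (n : ZMod 3) = 2) :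
    Ts n (fun A x d => (i3 A * (-4*A*A - 4*A*x + 10/3*A*d + 25/3*d*d - 13/3*x*x + 4*x*d)
      + i3 (A - d) * (-8/3*A*A - 2*A*x + 4/3*A*d + 10/3*d*d)) + (4 * ff x + ff (x + d))) =
    Ds n (fun d e => (9*(d:ℚ)*e*((d:ℚ)+e) - ((d:ℚ)+e)^3 - 3*((d:ℚ)+e)^2) / 2) := by
  rw [Ts_eval]
  simp only [ff]
  refine Ds_sym fun d e hd he h => ?_
  rw [← h] at hn
  push_cast at hn
  obtain ⟨k, rfl | rfl | rfl⟩ := mod3 d <;> obtain ⟨l, rfl | rfl | rfl⟩ := mod3 e <;>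
  push_cast [three0, zero_mul, zero_add] at hn <;>
  first
  | (exfalso; revert hn; decide)
  | (clear hn
     (first | rw [tri_0 _ k hd] | rw [tri_1 _ k hd] | rw [tri_2 _ k hd]) <;>
     (first | rw [tri_0 _ l he] | rw [tri_1 _ l he] | rw [tri_2 _ l he] | skip) <;>
     simp only [Quad, triV] <;>
     (try intro m) <;>
     simp only [i3, c3] <;>
     push_cast <;>
     simp (decide := true) only [three0, I3, X3, if_true, if_false,
      Int.cast_zero, Int.cast_one, Int.cast_neg, mul_zero, zero_mul, mul_one, add_zero, zero_add, sub_zero] <;>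
     ring)

lemma caseB (n : ℤ) (hn : (n : ZMod 3) = 2) : 2 * TW n ff =
    Ds n (fun d e => 3 * ((d:ℚ) * e * d - if d < e then 2 * ((d:ℚ) * e) * d + 2 * (d:ℚ) ^ 3 else 0)) := by
  rw [total_ff n (by rw [hn]; decide), certB n hn, tieB n hn, ← Ts_add, valB n hn, ← Ds_add]
  refine Ds_sym fun d e hd he h5 => ?_
  have h := h5
  have : ff (d + e) = (d + e) ^ 2 := by
    rw [ff_eq]
    · push_cast; rfl
    · rw [← h] at hn; push_cast at hn ⊢
      generalize (d : ZMod 3) = a at *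
      generalize (e : ZMod 3) = b at *
      revert a b; decide
  rw [add_comm e d, this]
  rcases lt_trichotomy d e with h | h | h
  · rw [if_pos h, if_pos h, if_neg h.not_gt, if_neg h.not_gt, min_eq_left h.le, min_eq_right h.le]
    push_cast; ring
  · exfalso; subst h; rw [← h5] at hn; push_cast at hn
    revert hn; generalize (d : ZMod 3) = a; revert a; decide
  · rw [if_pos h, if_pos h, if_neg h.not_gt, if_neg h.not_gt, min_eq_left h.le, min_eq_right h.le]
    push_cast; ring


abbrev SLZ := Matrix.SpecialLinearGroup (Fin 2) ℤ

lemma act_mul (γ δ : SLZ) (Q : ℤ × ℤ × ℤ) : formAct γ (formAct δ Q) = formAct (δ * γ) Q := by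
  obtain ⟨a, b, c⟩ := Q
  simp only [formAct, formEval, Matrix.SpecialLinearGroup.coe_mul, Matrix.mul_apply, Fin.sum_univ_two,
    Prod.mk.injEq]
  refine ⟨by ring, by ring, by ring⟩

lemma act_one (Q : ℤ × ℤ × ℤ) : formAct 1 Q = Q := by
  obtain ⟨a, b, c⟩ := Q
  simp [formAct, formEval]
  ring

lemma det_eq (γ : SLZ) : γ.1 0 0 * γ.1 1 1 - γ.1 0 1 * γ.1 1 0 = 1 := by
  have := γ.2
  rwa [Matrix.det_fin_two] at this

lemma act_disc (γ : SLZ) (Q : ℤ × ℤ × ℤ) : formDisc (formAct γ Q) = formDisc Q := by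
  obtain ⟨a, b, c⟩ := Q
  have h := det_eq γ
  simp only [formAct, formEval, formDisc]
  generalize γ.1 0 0 = x at *
  generalize γ.1 0 1 = y at *
  generalize γ.1 1 0 = z at *
  generalize γ.1 1 1 = w at *
  linear_combination (b ^ 2 - 4 * a * c) * (x * w - y * z + 1) * h

lemma act_pos (γ : SLZ) (Q : ℤ × ℤ × ℤ) (hQ : IsPosDef Q) : IsPosDef (formAct γ Q) := by
  refine ⟨?_, by rw [act_disc]; exact hQ.2⟩
  obtain ⟨a, b, c⟩ := Q
  obtain ⟨h1, h2⟩ := hQ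
  have h := det_eq γ
  simp only [formAct, formEval, formDisc] at *
  generalize γ.1 0 0 = x at *
  generalize γ.1 0 1 = y at *
  generalize γ.1 1 0 = z at *
  generalize γ.1 1 1 = w at *
  have h3 : 0 < 4 * a * (a * x ^ 2 + b * x * z + c * z ^ 2) := by
    have e : 4 * a * (a * x ^ 2 + b * x * z + c * z ^ 2) =
      (2 * a * x + b * z) ^ 2 + (4 * a * c - b ^ 2) * z ^ 2 := by ring
    rw [e]
    by_cases hz : z = 0
    · subst hz
      have hx : x ≠ 0 := by rintro rfl; simp at h
      have : 2 * a * x + b * 0 ≠ 0 := by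
        rw [mul_zero, add_zero]; exact mul_ne_zero (by omega) hx
      have h5 : 0 < (2 * a * x + b * 0) ^ 2 := by positivity
      linarith
    · have : 0 < 4 * a * c - b ^ 2 := by linarith
      positivity
  exact pos_of_mul_pos_right (by linarith : 0 < 4 * a * (a * x ^ 2 + b * x * z + c * z ^ 2)) (by omega)

/-- reducedness in the obtuse sense -/
def Red (Q : ℤ × ℤ × ℤ) : Prop := 0 ≤ 2 * Q.1 + Q.2.1 ∧ 0 ≤ 2 * Q.2.2 + Q.2.1 ∧ Q.2.1 ≤ 0

def sz (Q : ℤ × ℤ × ℤ) : ℤ := 2 * Q.1 + 2 * Q.2.2 + Q.2.1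

def ps (s t : ℤ) : ℤ := s ^ 2 + s * t + t ^ 2

lemma sz_act (γ : SLZ) (a b c : ℤ) : sz (formAct γ (a, b, c)) =
    (2 * a + b) * ps (γ.1 0 0) (γ.1 0 1) + (2 * c + b) * ps (γ.1 1 0) (γ.1 1 1)
     + (-b) * ps (γ.1 0 0 - γ.1 1 0) (γ.1 0 1 - γ.1 1 1) := by
  simp only [sz, formAct, formEval, ps]; ring

lemma ps_pos (s t : ℤ) (h : ¬ (s = 0 ∧ t = 0)) : 1 ≤ ps s t := by
  unfold ps
  by_contra h'
  push Not at h'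
  have h1 : 4 * (s ^ 2 + s * t + t ^ 2) = (2 * s + t) ^ 2 + 3 * t ^ 2 := by ring
  have h2 : t = 0 := by
    by_contra h3
    have : 0 < t ^ 2 := by positivity
    nlinarith [sq_nonneg (2 * s + t)]
  subst h2
  have : s ≠ 0 := fun h3 => h ⟨h3, rfl⟩
  have : 0 < s ^ 2 := by positivity
  nlinarith

lemma ps_rows (γ : SLZ) : 1 ≤ ps (γ.1 0 0) (γ.1 0 1) ∧ 1 ≤ ps (γ.1 1 0) (γ.1 1 1) ∧
    1 ≤ ps (γ.1 0 0 - γ.1 1 0) (γ.1 0 1 - γ.1 1 1) := by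
  have h := det_eq γ
  refine ⟨ps_pos _ _ ?_, ps_pos _ _ ?_, ps_pos _ _ ?_⟩
  · rintro ⟨h1, h2⟩; rw [h1, h2] at h; simp at h
  · rintro ⟨h1, h2⟩; rw [h1, h2] at h; simp at h
  · rintro ⟨h1, h2⟩
    rw [sub_eq_zero.1 h1, sub_eq_zero.1 h2] at h
    have : γ.1 1 0 * γ.1 1 1 - γ.1 1 1 * γ.1 1 0 = 0 := by ring
    omega

lemma sz_le (γ : SLZ) (Q : ℤ × ℤ × ℤ) (hQ : Red Q) : sz Q ≤ sz (formAct γ Q) := by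
  obtain ⟨a, b, c⟩ := Q
  obtain ⟨h1, h2, h3⟩ := hQ
  simp only at h1 h2 h3
  rw [sz_act]
  obtain ⟨g1, g2, g3⟩ := ps_rows γ
  simp only [sz]
  have := mul_le_mul_of_nonneg_left g1 h1
  have := mul_le_mul_of_nonneg_left g2 h2
  have := mul_le_mul_of_nonneg_left g3 (by omega : 0 ≤ -b)
  linarith

lemma sz_eq (γ : SLZ) (Q : ℤ × ℤ × ℤ) (hQ : Red Q) (hQ' : Red (formAct γ Q)) :
    sz (formAct γ Q) = sz Q := by
  refine le_antisymm ?_ (sz_le γ Q hQ)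
  have := sz_le γ⁻¹ _ hQ'
  rwa [act_mul, mul_inv_cancel, act_one] at this

/-- the six unit vectors -/
def Ph : Finset (ℤ × ℤ) := {(1, 0), (-1, 0), (0, 1), (0, -1), (1, -1), (-1, 1)}

lemma ps_one (s t : ℤ) (h : ps s t = 1) : (s, t) ∈ Ph := by
  unfold ps at h
  have h1 : (2 * s + t) ^ 2 + 3 * t ^ 2 = 4 := by linarith
  have h2 : (2 * t + s) ^ 2 + 3 * s ^ 2 = 4 := by linarith
  have t1 : t ≤ 1 := by nlinarith [sq_nonneg (2 * s + t)]
  have t2 : -1 ≤ t := by nlinarith [sq_nonneg (2 * s + t)]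
  have s1 : s ≤ 1 := by nlinarith [sq_nonneg (2 * t + s)]
  have s2 : -1 ≤ s := by nlinarith [sq_nonneg (2 * t + s)]
  interval_cases t <;> interval_cases s <;> first | (exfalso; omega) | decide

/-- rows -/
def rows (γ : SLZ) : (ℤ × ℤ) × (ℤ × ℤ) := ((γ.1 0 0, γ.1 0 1), (γ.1 1 0, γ.1 1 1))

def F12 : Finset ((ℤ × ℤ) × (ℤ × ℤ)) :=
  (Ph ×ˢ Ph).filter (fun v => v.1.1 * v.2.2 - v.1.2 * v.2.1 = 1)
def F6 : Finset ((ℤ × ℤ) × (ℤ × ℤ)) :=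
  F12.filter (fun v => ps (v.1.1 - v.2.1) (v.1.2 - v.2.2) = 1)

lemma F12_card : F12.card = 12 := by decide
lemma F6_card : F6.card = 6 := by decide

lemma rows_inj : Function.Injective rows := by
  intro γ δ h
  simp only [rows, Prod.mk.injEq] at h
  ext i j
  fin_cases i <;> fin_cases j
  · exact h.1.1
  · exact h.1.2
  · exact h.2.1
  · exact h.2.2

lemma rows_surj (v : (ℤ × ℤ) × (ℤ × ℤ)) (h : v.1.1 * v.2.2 - v.1.2 * v.2.1 = 1) :
    ∃ γ, rows γ = v := by
  refine ⟨⟨!![v.1.1, v.1.2; v.2.1, v.2.2], ?_⟩, ?_⟩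
  · rw [Matrix.det_fin_two_of]; exact h
  · simp [rows]

/-- weight -/
def wt (Q : ℤ × ℤ × ℤ) : ℚ :=
  (if 0 < 2 * Q.1 + Q.2.1 ∧ 0 < 2 * Q.2.2 + Q.2.1 ∧ 0 < -Q.2.1 then 1 else 0) +
  1 / 2 * (if -Q.2.1 = 0 ∧ 0 < 2 * Q.1 + Q.2.1 ∧ 0 < 2 * Q.2.2 + Q.2.1 then 1 else 0) +
  1 / 2 * (if 2 * Q.1 + Q.2.1 = 0 ∧ 0 < 2 * Q.2.2 + Q.2.1 ∧ 0 < -Q.2.1 then 1 else 0) +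
  1 / 2 * (if 2 * Q.2.2 + Q.2.1 = 0 ∧ 0 < 2 * Q.1 + Q.2.1 ∧ 0 < -Q.2.1 then 1 else 0)

/-- the action in terms of rows -/
def actR (v : (ℤ × ℤ) × (ℤ × ℤ)) (Q : ℤ × ℤ × ℤ) : ℤ × ℤ × ℤ :=
  (formEval Q v.1.1 v.2.1, formEval Q (v.1.1 + v.1.2) (v.2.1 + v.2.2)
     - formEval Q v.1.1 v.2.1 - formEval Q v.1.2 v.2.2, formEval Q v.1.2 v.2.2)

lemma act_rows (γ : SLZ) (Q : ℤ × ℤ × ℤ) : formAct γ Q = actR (rows γ) Q := rfl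

/-- type one -/
def Ty1 (Q : ℤ × ℤ × ℤ) : Prop := 0 < 2 * Q.1 + Q.2.1 ∧ 0 < 2 * Q.2.2 + Q.2.1 ∧ 0 < -Q.2.1
/-- type two -/
def Ty2 (Q : ℤ × ℤ × ℤ) : Prop := 0 < Q.1 ∧ 0 < Q.2.2 ∧ Q.2.1 = 0

lemma F12_list : ∀ v ∈ F12, v = ((1,0),(0,1)) ∨ v = ((1,0),(-1,1)) ∨ v = ((-1,0),(0,-1)) ∨
    v = ((-1,0),(1,-1)) ∨ v = ((0,1),(-1,0)) ∨ v = ((0,1),(-1,1)) ∨ v = ((0,-1),(1,0)) ∨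
    v = ((0,-1),(1,-1)) ∨ v = ((1,-1),(1,0)) ∨ v = ((1,-1),(0,1)) ∨ v = ((-1,1),(-1,0)) ∨
    v = ((-1,1),(0,-1)) := by decide
lemma F6_list : ∀ v ∈ F6, v = ((1,0),(0,1)) ∨ v = ((-1,0),(0,-1)) ∨
    v = ((0,1),(-1,1)) ∨ 
    v = ((0,-1),(1,-1)) ∨ v = ((1,-1),(1,0)) ∨ v = ((-1,1),(-1,0))  := by decide

lemma one1 (Q : ℤ × ℤ × ℤ) (hQ : Ty1 Q) (v) (hv : v ∈ F6) : Red (actR v Q) ∧ wt (actR v Q) = 1 := by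
  obtain ⟨a, b, c⟩ := Q
  obtain ⟨h1, h2, h3⟩ := hQ
  simp only at h1 h2 h3
  have : Ty1 (actR v (a, b, c)) := by
    rcases F6_list v hv with rfl | rfl | rfl | rfl | rfl | rfl <;>
    simp only [Ty1, actR, formEval] <;> ring_nf <;> omega
  refine ⟨⟨this.1.le, this.2.1.le, by have := this.2.2; omega⟩, ?_⟩
  obtain ⟨g1, g2, g3⟩ := this
  unfold wt
  rw [if_pos ⟨g1, g2, g3⟩, if_neg (by omega), if_neg (by omega), if_neg (by omega)]; norm_num

lemma one2 (Q : ℤ × ℤ × ℤ) (hQ : Ty2 Q) (v) (hv : v ∈ F12) :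
    Red (actR v Q) ∧ wt (actR v Q) = 1 / 2 := by
  obtain ⟨a, b, c⟩ := Q
  obtain ⟨h1, h2, h3⟩ := hQ
  simp only at h1 h2 h3
  subst h3
  generalize hR : actR v (a, 0, c) = R
  obtain ⟨a', b', c'⟩ := R
  have : (b' = 0 ∧ 0 < 2 * a' + b' ∧ 0 < 2 * c' + b') ∨ (0 < -b' ∧ 0 = 2 * a' + b' ∧ 0 < 2 * c' + b')
    ∨ (0 < -b' ∧ 0 < 2 * a' + b' ∧ 0 = 2 * c' + b') := by
    rcases F12_list v hv with rfl | rfl | rfl | rfl | rfl | rfl | rfl | rfl | rfl | rfl | rfl | rfl <;>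
    simp only [actR, formEval, Prod.mk.injEq] at hR <;> ring_nf at hR <;> omega
  refine ⟨?_, ?_⟩
  · simp only [Red]; omega
  · simp only [wt]
    rcases this with h | h | h
    · rw [if_neg (by omega), if_pos (by omega), if_neg (by omega), if_neg (by omega)]; norm_num
    · rw [if_neg (by omega), if_neg (by omega), if_pos (by omega), if_neg (by omega)]; norm_num
    · rw [if_neg (by omega), if_neg (by omega), if_neg (by omega), if_pos (by omega)]; norm_num

lemma two1 (Q : ℤ × ℤ × ℤ) (hQ : Ty1 Q) (γ : SLZ) (h : Red (formAct γ Q)) : rows γ ∈ F6 := by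
  obtain ⟨h1, h2, h3⟩ := hQ
  have e := sz_eq γ Q ⟨h1.le, h2.le, by omega⟩ h
  obtain ⟨a, b, c⟩ := Q
  simp only at h1 h2 h3
  rw [sz_act] at e
  obtain ⟨g1, g2, g3⟩ := ps_rows γ
  simp only [sz] at e
  have k1 := mul_le_mul_of_nonneg_left g1 h1.le
  have k2 := mul_le_mul_of_nonneg_left g2 h2.le
  have k3 := mul_le_mul_of_nonneg_left g3 h3.le
  have l1 : ps (γ.1 0 0) (γ.1 0 1) = 1 := mul_left_cancel₀ h1.ne' (by linarith)
  have l2 : ps (γ.1 1 0) (γ.1 1 1) = 1 := mul_left_cancel₀ h2.ne' (by linarith)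
  have l3 : ps (γ.1 0 0 - γ.1 1 0) (γ.1 0 1 - γ.1 1 1) = 1 := mul_left_cancel₀ h3.ne' (by linarith)
  simp only [F6, F12, Finset.mem_filter, Finset.mem_product, rows]
  exact ⟨⟨⟨ps_one _ _ l1, ps_one _ _ l2⟩, det_eq γ⟩, l3⟩

lemma two2 (Q : ℤ × ℤ × ℤ) (hQ : Ty2 Q) (γ : SLZ) (h : Red (formAct γ Q)) : rows γ ∈ F12 := by
  obtain ⟨h1, h2, h3⟩ := hQ
  have e := sz_eq γ Q ⟨by omega, by omega, by omega⟩ h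
  obtain ⟨a, b, c⟩ := Q
  simp only at h1 h2 h3
  rw [sz_act] at e
  obtain ⟨g1, g2, g3⟩ := ps_rows γ
  simp only [sz] at e
  subst h3
  have k1 := mul_le_mul_of_nonneg_left g1 h1.le
  have k2 := mul_le_mul_of_nonneg_left g2 h2.le
  have l1 : ps (γ.1 0 0) (γ.1 0 1) = 1 := mul_left_cancel₀ h1.ne' (by linarith)
  have l2 : ps (γ.1 1 0) (γ.1 1 1) = 1 := mul_left_cancel₀ h2.ne' (by linarith)
  simp only [F12, Finset.mem_filter, Finset.mem_product, rows]
  exact ⟨⟨ps_one _ _ l1, ps_one _ _ l2⟩, det_eq γ⟩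

/-- generators -/
def mS : SLZ := ⟨!![0, 1; -1, 0], by simp⟩
def mT : SLZ := ⟨!![1, 1; 0, 1], by simp⟩
def mU : SLZ := ⟨!![1, 0; 1, 1], by simp⟩

lemma act_S (a b c : ℤ) : formAct mS (a, b, c) = (c, -b, a) := by
  simp [formAct, formEval, mS]
lemma act_T (a b c : ℤ) : formAct mT (a, b, c) = (a, b + 2 * a, a + b + c) := by
  simp [formAct, formEval, mT]; ring
lemma act_U (a b c : ℤ) : formAct mU (a, b, c) = (a + b + c, b + 2 * c, c) := by
  simp [formAct, formEval, mU]; ring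

lemma pos_facts (a b c : ℤ) (h : IsPosDef (a, b, c)) : 0 < a ∧ 0 < c ∧ 0 < 2 * a + 2 * c + b := by
  obtain ⟨h1, h2⟩ := h
  simp only [formDisc] at h1 h2
  have h3 : 0 < c := by nlinarith [sq_nonneg b]
  refine ⟨h1, h3, ?_⟩
  by_contra h4
  nlinarith [sq_nonneg (a - c)]

lemma exRed (m : ℕ) : ∀ Q : ℤ × ℤ × ℤ, IsPosDef Q → sz Q ≤ m → ∃ γ, Red (formAct γ Q) := by
  induction m with
  | zero =>
    rintro ⟨a, b, c⟩ hQ h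
    have := pos_facts a b c hQ
    simp only [sz] at h; push_cast at h; omega
  | succ m ih =>
    rintro ⟨a, b, c⟩ hQ h
    have := pos_facts a b c hQ
    have step : ∀ δ : SLZ, sz (formAct δ (a, b, c)) ≤ m → ∃ γ, Red (formAct γ (a, b, c)) := by
      intro δ hδ
      obtain ⟨γ, hγ⟩ := ih _ (act_pos δ _ hQ) hδ
      exact ⟨δ * γ, by rwa [act_mul] at hγ⟩
    simp only [sz] at h; push_cast at h
    by_cases h1 : 0 < b
    · apply step mS; rw [act_S]; simp only [sz]; omega
    by_cases h2 : 2 * a + b < 0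
    · apply step mT; rw [act_T]; simp only [sz]; omega
    by_cases h3 : 2 * c + b < 0
    · apply step mU; rw [act_U]; simp only [sz]; omega
    refine ⟨1, ?_⟩
    rw [act_one]
    simp only [Red]; omega

lemma exTy (Q : ℤ × ℤ × ℤ) (hQ : IsPosDef Q) : ∃ γ, Ty1 (formAct γ Q) ∨ Ty2 (formAct γ Q) := by
  obtain ⟨γ, hγ⟩ := exRed (sz Q).toNat Q hQ (Int.self_le_toNat _)
  have hp := act_pos γ Q hQ
  have key : ∀ Q' : ℤ × ℤ × ℤ, IsPosDef Q' → Red Q' → ∃ δ, Ty1 (formAct δ Q') ∨ Ty2 (formAct δ Q') := by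
    rintro ⟨a, b, c⟩ hp ⟨h1, h2, h3⟩
    simp only at h1 h2 h3
    have h4 := pos_facts a b c hp
    by_cases h5 : b = 0
    · refine ⟨1, ?_⟩; rw [act_one]; right; simp only [Ty2]; omega
    have h8 : ¬ (2 * a + b = 0 ∧ 2 * c + b = 0) := by
      rintro ⟨h6, h7⟩
      have := hp.2
      simp only [formDisc] at this
      obtain rfl : b = -2 * a := by omega
      obtain rfl : a = c := by omega
      nlinarith
    by_cases h6 : 2 * a + b = 0
    · refine ⟨mT, ?_⟩; rw [act_T]; right; simp only [Ty2]; omega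
    by_cases h7 : 2 * c + b = 0
    · refine ⟨mU, ?_⟩; rw [act_U]; right; simp only [Ty2]; omega
    · refine ⟨1, ?_⟩; rw [act_one]; left; simp only [Ty1]; omega
  obtain ⟨δ, hδ⟩ := key _ hp hγ
  rw [act_mul] at hδ
  exact ⟨_, hδ⟩



/-- reduced forms of discriminant `-N` -/
noncomputable def Sf (N : ℤ) : Finset (ℤ × ℤ × ℤ) :=
  ((Finset.Icc 0 N) ×ˢ (Finset.Icc (-N) 0) ×ˢ (Finset.Icc 0 N)).filter
    (fun Q => (0 ≤ 2 * Q.1 + Q.2.1 ∧ 0 ≤ 2 * Q.2.2 + Q.2.1 ∧ Q.2.1 ≤ 0) ∧ Q.2.1 ^ 2 - 4 * Q.1 * Q.2.2 = -N)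

lemma mem_Sf (N : ℤ) (hN : 0 < N) (Q : ℤ × ℤ × ℤ) : Q ∈ Sf N ↔ Red Q ∧ formDisc Q = -N := by
  obtain ⟨a, b, c⟩ := Q
  simp only [Sf, Finset.mem_filter, Finset.mem_product, Finset.mem_Icc, Red, formDisc]
  constructor
  · rintro ⟨-, h⟩; exact h
  · rintro ⟨⟨h1, h2, h3⟩, h4⟩
    refine ⟨?_, ⟨h1, h2, h3⟩, h4⟩
    have e : (2 * a + b) * (2 * c + b) + (2 * c + b) * (-b) + (-b) * (2 * a + b) = N := by linarith
    generalize hp : 2 * a + b = p at *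
    generalize hq : 2 * c + b = q at *
    generalize hr : -b = r at *
    have r0 : 0 ≤ r := by omega
    have a1 := mul_nonneg h1 h2
    have a2 := mul_nonneg h2 r0
    have a3 := mul_nonneg r0 h1
    have key : ∀ x y z : ℤ, 0 ≤ x → 0 ≤ y → 0 ≤ z → x * y + y * z + z * x = N → x ≤ N := by
      intro x y z hx hy hz h
      by_cases h0 : y + z = 0
      · obtain rfl : y = 0 := by omega
        obtain rfl : z = 0 := by omega
        simp at h; omega
      · have : 1 ≤ y + z := by omega
        nlinarith [mul_nonneg hy hz, mul_nonneg hx (by omega : 0 ≤ y + z - 1)]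
    have p1 := key p q r h1 h2 r0 e
    have p2 := key q r p h2 r0 h1 (by linarith)
    have p3 := key r p q r0 h1 h2 (by linarith)
    omega

lemma card_orb (Q : ℤ × ℤ × ℤ) : Nat.card {γ : SLZ // Red (formAct γ Q)} =
    Nat.card {Q' // Red Q' ∧ ∃ γ : SLZ, formAct γ Q = Q'} * Nat.card {γ : SLZ // formAct γ Q = Q} := by
  rw [← Nat.card_prod]
  choose s hs using fun Q' : {Q' // Red Q' ∧ ∃ γ : SLZ, formAct γ Q = Q'} => Q'.2.2
  refine Nat.card_congr ?_
  refine ⟨fun γ => (⟨formAct γ.1 Q, γ.2, γ.1, rfl⟩,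
      ⟨γ.1 * (s ⟨formAct γ.1 Q, γ.2, γ.1, rfl⟩)⁻¹, ?_⟩),
    fun v => ⟨v.2.1 * s v.1, ?_⟩, ?_, ?_⟩
  · rw [← act_mul]
    set Q' : {Q' // Red Q' ∧ ∃ γ : SLZ, formAct γ Q = Q'} := ⟨formAct γ.1 Q, γ.2, γ.1, rfl⟩
    have h := hs Q'
    have : formAct γ.1 Q = Q'.1 := rfl
    rw [this, ← h, act_mul, mul_inv_cancel, act_one]
  · rw [← act_mul, v.2.2, hs]
    exact v.1.2.1
  · intro γ; simp
  · rintro ⟨Q', γ, hγ⟩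
    have h1 : formAct (γ * s Q') Q = Q'.1 := by rw [← act_mul, hγ, hs]
    have h2 : (⟨formAct (γ * s Q') Q, by rw [h1]; exact Q'.2.1, γ * s Q', rfl⟩ :
      {Q' // Red Q' ∧ ∃ γ : SLZ, formAct γ Q = Q'}) = Q' := Subtype.ext h1
    refine Prod.ext h2 (Subtype.ext ?_)
    simp only
    rw [h2]; group

lemma card_fin {α : Type*} (F : Finset α) : Nat.card F = F.card := by simp

lemma card_rows (Q : ℤ × ℤ × ℤ) (F : Finset ((ℤ × ℤ) × (ℤ × ℤ)))
    (hF : ∀ v ∈ F, v.1.1 * v.2.2 - v.1.2 * v.2.1 = 1)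
    (h : ∀ γ : SLZ, Red (formAct γ Q) ↔ rows γ ∈ F) : Nat.card {γ : SLZ // Red (formAct γ Q)} = F.card := by
  rw [← card_fin]
  refine Nat.card_congr (Equiv.ofBijective (fun γ => ⟨rows γ.1, (h γ.1).1 γ.2⟩) ⟨?_, ?_⟩)
  · intro γ δ hh
    exact Subtype.ext (rows_inj (by simpa using hh))
  · rintro ⟨v, hv⟩
    obtain ⟨γ, hγ⟩ := rows_surj v (hF v hv)
    exact ⟨⟨γ, (h γ).2 (by rw [hγ]; exact hv)⟩, Subtype.ext hγ⟩

open Classical in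
lemma orb_aux (N : ℤ) (hN : 0 < N) (Q : ℤ × ℤ × ℤ) (hd : formDisc Q = -N)
    (F : Finset ((ℤ × ℤ) × (ℤ × ℤ))) (w : ℚ)
    (hF : ∀ v ∈ F, v.1.1 * v.2.2 - v.1.2 * v.2.1 = 1)
    (h : ∀ γ : SLZ, Red (formAct γ Q) ↔ rows γ ∈ F)
    (hw : ∀ γ : SLZ, Red (formAct γ Q) → wt (formAct γ Q) = w) (h6 : (F.card : ℚ) * w = 6) :
    ∑ Q' ∈ Sf N, (if ∃ γ : SLZ, formAct γ Q = Q' then wt Q' else 0) =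
      6 / (Nat.card {γ : SLZ // formAct γ Q = Q} : ℚ) := by
  have e1 : ∑ Q' ∈ Sf N, (if ∃ γ : SLZ, formAct γ Q = Q' then wt Q' else 0) =
     (Nat.card {Q' // Red Q' ∧ ∃ γ : SLZ, formAct γ Q = Q'} : ℚ) * w := by
    rw [← Finset.sum_filter]
    rw [Finset.sum_congr rfl (g := fun _ => w)]
    · rw [Finset.sum_const, nsmul_eq_mul, ← card_fin]
      congr 2
      refine Nat.card_congr (Equiv.subtypeEquivRight ?_)
      intro Q'
      rw [Finset.mem_filter, mem_Sf N hN]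
      constructor
      · rintro ⟨⟨h1, h2⟩, h3⟩; exact ⟨h1, h3⟩
      · rintro ⟨h1, γ, rfl⟩; exact ⟨⟨h1, by rw [act_disc, hd]⟩, γ, rfl⟩
    · intro Q' hQ'
      rw [Finset.mem_filter, mem_Sf N hN] at hQ'
      obtain ⟨⟨h1, h2⟩, γ, rfl⟩ := hQ'
      exact hw γ h1
  have e2 := card_orb Q
  rw [card_rows Q F hF h] at e2
  rw [e1]
  have e3 : (F.card : ℚ) = (Nat.card {Q' // Red Q' ∧ ∃ γ : SLZ, formAct γ Q = Q'} : ℚ) *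
    (Nat.card {γ : SLZ // formAct γ Q = Q} : ℚ) := by exact_mod_cast e2
  have h0 : (Nat.card {γ : SLZ // formAct γ Q = Q} : ℚ) ≠ 0 := by
    intro h0; rw [h0, mul_zero] at e3; rw [e3, zero_mul] at h6; norm_num at h6
  rw [eq_div_iff h0, ← h6, e3]; ring

open Classical in
lemma orb (N : ℤ) (hN : 0 < N) (Q : ℤ × ℤ × ℤ) (hd : formDisc Q = -N) (hQ : IsPosDef Q) :
    ∑ Q' ∈ Sf N, (if ∃ γ : SLZ, formAct γ Q = Q' then wt Q' else 0) =
      6 / (Nat.card {γ : SLZ // formAct γ Q = Q} : ℚ) := by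
  obtain ⟨δ, hδ⟩ := exTy Q hQ
  have c1 : Nat.card {γ : SLZ // formAct γ Q = Q} =
      Nat.card {γ : SLZ // formAct γ (formAct δ Q) = formAct δ Q} := by
    refine Nat.card_congr ⟨fun γ => ⟨δ⁻¹ * γ.1 * δ, ?_⟩, fun γ => ⟨δ * γ.1 * δ⁻¹, ?_⟩, ?_, ?_⟩
    · rw [act_mul, show δ * (δ⁻¹ * γ.1 * δ) = γ.1 * δ by group, ← act_mul, γ.2]
    · rw [← act_mul, ← act_mul, γ.2, act_mul, mul_inv_cancel, act_one]
    · intro γ; apply Subtype.ext; simp only; group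
    · intro γ; apply Subtype.ext; simp only; group
  have c2 : ∀ Q', (∃ γ : SLZ, formAct γ Q = Q') ↔ ∃ γ : SLZ, formAct γ (formAct δ Q) = Q' := by
    intro Q'
    constructor
    · rintro ⟨γ, rfl⟩; exact ⟨δ⁻¹ * γ, by rw [act_mul]; congr 1; group⟩
    · rintro ⟨γ, rfl⟩; exact ⟨δ * γ, by rw [act_mul]⟩
  rw [c1]
  simp only [c2]
  have hd' : formDisc (formAct δ Q) = -N := by rw [act_disc, hd]
  rcases hδ with h | h
  · refine orb_aux N hN _ hd' F6 1 ?_ ?_ ?_ ?_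
    · intro v hv; simp only [F6, F12, Finset.mem_filter] at hv; exact hv.1.2
    · intro γ; exact ⟨two1 _ h γ, fun hv => by rw [act_rows]; exact (one1 _ h _ hv).1⟩
    · intro γ hγ; rw [act_rows γ]; exact (one1 _ h _ (two1 _ h γ hγ)).2
    · rw [F6_card]; norm_num
  · refine orb_aux N hN _ hd' F12 (1 / 2) ?_ ?_ ?_ ?_
    · intro v hv; simp only [F12, Finset.mem_filter] at hv; exact hv.2
    · intro γ; exact ⟨two2 _ h γ, fun hv => by rw [act_rows]; exact (one2 _ h _ hv).1⟩
    · intro γ hγ; rw [act_rows γ]; exact (one2 _ h _ (two2 _ h γ hγ)).2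
    · rw [F12_card]; norm_num

lemma cls_eq (N : ℤ) (Q Q' : {Q : ℤ × ℤ × ℤ // formDisc Q = -N ∧ IsPosDef Q}) :
    (Quot.mk _ Q : FormClasses N) = Quot.mk _ Q' ↔ ∃ γ : SLZ, formAct γ Q.1 = Q'.1 := by
  constructor
  · intro h
    have h1 := Quot.eqvGen_exact h
    rwa [Equivalence.eqvGen_iff] at h1
    refine ⟨fun Q => ⟨1, act_one _⟩, ?_, ?_⟩
    · rintro Q Q' ⟨γ, h⟩; exact ⟨γ⁻¹, by rw [← h, act_mul, mul_inv_cancel, act_one]⟩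
    · rintro Q Q' Q'' ⟨γ, h⟩ ⟨δ, h'⟩; exact ⟨γ * δ, by rw [← act_mul, h, h']⟩
  · intro h; exact Quot.sound h

lemma red_pos (N : ℤ) (hN : 0 < N) (Q : ℤ × ℤ × ℤ) (h : Q ∈ Sf N) : IsPosDef Q := by
  rw [mem_Sf N hN] at h
  obtain ⟨⟨h1, h2, h3⟩, h4⟩ := h
  refine ⟨?_, by omega⟩
  by_contra h5
  have e1 : Q.1 = 0 := by omega
  have e2 : Q.2.1 = 0 := by omega
  simp only [formDisc, e1, e2] at h4
  simp at h4; omega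

open Classical in
lemma H_pos (N : ℤ) (hN : 0 < N) : 3 * hurwitzClassNumber N = ((∑ Q ∈ Sf N, wt Q : ℚ) : ℝ) := by
  have fin : Finite (FormClasses N) := by
    refine Finite.of_surjective (fun Q : {Q // Q ∈ Sf N} =>
      (Quot.mk _ ⟨Q.1, ((mem_Sf N hN Q.1).1 Q.2).2, red_pos N hN Q.1 Q.2⟩ : FormClasses N)) ?_
    intro c
    induction c using Quot.ind with
    | _ Q =>
    obtain ⟨γ, hγ⟩ := exRed (sz Q.1).toNat Q.1 Q.2.2 (Int.self_le_toNat _)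
    refine ⟨⟨formAct γ Q.1, ?_⟩, ?_⟩
    · rw [mem_Sf N hN]; exact ⟨hγ, by rw [act_disc]; exact Q.2.1⟩
    · symm
      rw [cls_eq]
      exact ⟨γ, rfl⟩
  have := Fintype.ofFinite (FormClasses N)
  unfold hurwitzClassNumber
  rw [if_neg hN.ne', finsum_eq_sum_of_fintype]
  have e1 : ∀ c : FormClasses N, (2 : ℝ) / (Nat.card {γ : SLZ // formAct γ c.out.1 = c.out.1}) =
     ((1 / 3 * ∑ Q' ∈ Sf N, (if ∃ γ : SLZ, formAct γ c.out.1 = Q' then wt Q' else 0) : ℚ) : ℝ) := by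
    intro c
    rw [orb N hN _ c.out.2.1 c.out.2.2]
    push_cast
    ring
  rw [Finset.sum_congr rfl (fun c _ => e1 c), ← Rat.cast_sum, ← Finset.mul_sum, Finset.sum_comm]
  have e2 : ∀ Q' ∈ Sf N, ∑ c : FormClasses N, (if ∃ γ : SLZ, formAct γ c.out.1 = Q' then wt Q' else 0) = wt Q' := by
    intro Q' hQ'
    have hh : ∀ c : FormClasses N, (∃ γ : SLZ, formAct γ c.out.1 = Q') ↔
        c = (Quot.mk _ ⟨Q', ((mem_Sf N hN Q').1 hQ').2, red_pos N hN Q' hQ'⟩ : FormClasses N) := by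
      intro c
      conv_rhs => rw [← Quot.out_eq c]
      rw [cls_eq]
    simp only [hh]
    rw [Finset.sum_ite_eq' Finset.univ]
    simp
  rw [Finset.sum_congr rfl e2]
  push_cast
  ring

lemma H_neg (N : ℤ) (hN : N < 0) : hurwitzClassNumber N = 0 := by
  unfold hurwitzClassNumber
  rw [if_neg hN.ne]
  have : IsEmpty (FormClasses N) := by
    constructor
    intro c
    have := c.out.2
    have h2 := this.2.2
    omega
  exact finsum_of_isEmpty _



def Wf (p q r : ℤ) : ℚ :=
  (if 0 < p ∧ 0 < q ∧ 0 < r then 1 else 0) + 1 / 2 * (if r = 0 ∧ 0 < p ∧ 0 < q then 1 else 0) +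
  1 / 2 * (if p = 0 ∧ 0 < q ∧ 0 < r then 1 else 0) + 1 / 2 * (if q = 0 ∧ 0 < p ∧ 0 < r then 1 else 0)

lemma As_smul (n : ℤ) (c : ℚ) (g : F4) : As n (fun A D x y => c * g A D x y) = c * As n g :=
  (Finset.mul_sum _ _ _).symm

lemma TW_W (n : ℤ) (f : ℤ → ℚ) : TW n f = As n (fun t p q r => f t * Wf p q r) := by
  have k8 : As n (fun t p q r => if p = 0 ∧ 0 < q ∧ 0 < r then f t else 0) =
      As n (fun t p q r => if r = 0 ∧ 0 < p ∧ 0 < q then f t else 0) := by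
    rw [As_pr]; congr 1; ext t p q r; refine if_congr ?_ rfl rfl; constructor <;> intro h <;> omega
  have k9 : As n (fun t p q r => if q = 0 ∧ 0 < p ∧ 0 < r then f t else 0) =
      As n (fun t p q r => if r = 0 ∧ 0 < p ∧ 0 < q then f t else 0) := by
    rw [As_pq, ← k8]
  have e : As n (fun t p q r => f t * Wf p q r) =
     As n (fun t p q r => if 0 < p ∧ 0 < q ∧ 0 < r then f t else 0) +
     1 / 2 * As n (fun t p q r => if r = 0 ∧ 0 < p ∧ 0 < q then f t else 0) +
     1 / 2 * As n (fun t p q r => if p = 0 ∧ 0 < q ∧ 0 < r then f t else 0) +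
     1 / 2 * As n (fun t p q r => if q = 0 ∧ 0 < p ∧ 0 < r then f t else 0) := by
    rw [← As_smul, ← As_smul, ← As_smul, ← As_add, ← As_add, ← As_add]
    congr 1; ext t p q r
    simp only [Wf, mul_add, mul_ite, mul_one, mul_zero]
    congr 1
    · congr 1
      · congr 1
        split_ifs <;> ring
      · split_ifs <;> ring
    · split_ifs <;> ring
  rw [e, k8, k9, TW]; ring

lemma wt_W (a b c : ℤ) : wt (a, b, c) = Wf (2 * a + b) (2 * c + b) (-b) := rfl

lemma Wf_ne {p q r : ℤ} (h : Wf p q r ≠ 0) : 0 ≤ p ∧ 0 ≤ q ∧ 0 ≤ r ∧ 0 < p + q ∧ 0 < q + r ∧ 0 < p + r := by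
  by_contra hc
  apply h
  unfold Wf
  rw [if_neg (by omega), if_neg (by omega), if_neg (by omega), if_neg (by omega)]
  simp

lemma link1 (n : ℤ) (hn : 0 < n) (f : ℤ → ℚ) : TW n f =
    ∑ t ∈ (Finset.Icc 1 (2 * n)).filter (fun t => t ^ 2 < 4 * n), f t * ∑ Q ∈ Sf (4 * n - t ^ 2), wt Q := by
  rw [TW_W]
  unfold As
  rw [← Finset.sum_filter_of_ne (p := fun v => 0 ≤ v.2.1 ∧ 0 ≤ v.2.2.1 ∧ 0 ≤ v.2.2.2 ∧ 0 < v.2.1 + v.2.2.1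
    ∧ 0 < v.2.2.1 + v.2.2.2 ∧ 0 < v.2.1 + v.2.2.2)
    (fun v _ hv => Wf_ne (right_ne_zero_of_mul hv))]
  simp_rw [Finset.mul_sum]
  rw [Finset.sum_sigma']
  refine Finset.sum_nbij' (fun v => ⟨v.1, ((v.2.1 + v.2.2.2) / 2, -v.2.2.2, (v.2.2.1 + v.2.2.2) / 2)⟩)
    (fun w => (w.1, 2 * w.2.1 + w.2.2.1, 2 * w.2.2.2 + w.2.2.1, -w.2.2.1)) ?_ ?_ ?_ ?_ ?_
  · rintro ⟨t, p, q, r⟩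
    simp only [Finset.mem_filter, mem_Am, Finset.mem_sigma, Finset.mem_Icc]
    rintro ⟨⟨⟨h0, -⟩, ⟨h5, h6, h7⟩, h8⟩, h9, h10, h11, h12, h13, h14⟩
    have hpos : 0 < p * q + q * r + r * p := by
      rcases h9.eq_or_lt with h | h
      · subst h
        have : 0 < q := by omega
        have : 0 < r := by omega
        have : 0 < q * r := by positivity
        linarith
      · have h1 := mul_pos h h13
        have h2 := mul_nonneg h10 h11
        linarith
    have ht : t ^ 2 < 4 * n := by linarith
    refine ⟨⟨⟨h0.1, by nlinarith⟩, ht⟩, (mem_Sf _ (by linarith) _).2 ?_⟩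
    obtain ⟨x, hx⟩ : ∃ A, p + r = 2 * A := ⟨(p + r) / 2, by omega⟩
    obtain ⟨y, hy⟩ : ∃ A, q + r = 2 * A := ⟨(q + r) / 2, by omega⟩
    obtain rfl : p = 2 * x - r := by omega
    obtain rfl : q = 2 * y - r := by omega
    rw [hx, hy]
    simp only [Int.mul_ediv_cancel_left _ (two_ne_zero), Red, formDisc]
    exact ⟨by omega, by linarith⟩
  · rintro ⟨t, a, b, c⟩
    simp only [Finset.mem_filter, mem_Am, Finset.mem_sigma, Finset.mem_Icc]
    rintro ⟨⟨h0, ht⟩, hQ⟩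
    rw [mem_Sf _ (by linarith)] at hQ
    simp only [Red, formDisc] at hQ
    obtain ⟨⟨h1, h2, h3⟩, h4⟩ := hQ
    have par : (t - b) % 2 = 0 := by
      have h5 : Even (t ^ 2 - b ^ 2) := ⟨2 * (n - a * c), by linarith⟩
      have h6 : Even (t - b) := by
        rw [Int.even_sub, Int.even_pow' two_ne_zero, Int.even_pow' two_ne_zero] at h5
        rwa [Int.even_sub]
      exact Int.even_iff.1 h6
    generalize hp : 2 * a + b = p at *
    generalize hq : 2 * c + b = q at *
    obtain ⟨r, rfl⟩ : ∃ r, b = -r := ⟨-b, by ring⟩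
    rw [neg_neg]
    have hr : 0 ≤ r := by omega
    have hE : p * q + q * r + r * p = 4 * n - t ^ 2 := by
      rw [← hp, ← hq]; linarith
    have m1 := mul_nonneg h1 h2
    have m2 := mul_nonneg h2 hr
    have m3 := mul_nonneg hr h1
    have b1 : 0 < p + q := by
      by_contra hc
      obtain rfl : p = 0 := by omega
      obtain rfl : q = 0 := by omega
      linarith
    have b2 : 0 < q + r := by
      by_contra hc
      obtain rfl : r = 0 := by omega
      obtain rfl : q = 0 := by omega
      linarith
    have b3 : 0 < p + r := by
      by_contra hc
      obtain rfl : p = 0 := by omega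
      obtain rfl : r = 0 := by omega
      linarith
    have tt := sq_nonneg t
    refine ⟨⟨⟨⟨h0.1, by linarith⟩, ⟨by linarith, ?_⟩, ⟨by linarith, ?_⟩, ⟨by linarith, ?_⟩⟩, ⟨by omega, by omega, by omega⟩, by linarith⟩,
      h1, h2, hr, b1, b2, b3⟩
    · nlinarith
    · nlinarith
    · nlinarith
  · rintro ⟨t, p, q, r⟩
    simp only [Finset.mem_filter, mem_Am, Prod.mk.injEq]
    rintro ⟨⟨⟨h0, -⟩, ⟨h5, h6, h7⟩, h8⟩, h9⟩
    refine ⟨trivial, ?_, ?_, ?_⟩ <;> omega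
  · rintro ⟨t, a, b, c⟩ _
    simp only [Sigma.mk.injEq, true_and, heq_eq_eq, Prod.mk.injEq]
    omega
  · rintro ⟨t, p, q, r⟩
    simp only [Finset.mem_filter, mem_Am]
    rintro ⟨⟨⟨h0, -⟩, ⟨h5, h6, h7⟩, h8⟩, h9⟩
    rw [wt_W]
    congr 2 <;> omega

lemma link (n : ℕ) (hn : 0 < n) (h3 : ¬ 3 ∣ n) : HH 2 0 3 n = ((2 / 3 * TW n ff : ℚ) : ℝ) := by
  have hN : (0 : ℤ) < n := by exact_mod_cast hn
  set g : ℤ → ℝ := fun t => if t % ((3 : ℕ) : ℤ) = 0 % ((3 : ℕ) : ℤ) then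
    (t : ℝ) ^ 2 * hurwitzClassNumber (4 * n - t ^ 2) else 0 with hg
  have g0 : g 0 = 0 := by simp [hg]
  have gneg : ∀ t, g (-t) = g t := by
    intro t
    simp only [hg]
    refine if_congr (by omega) ?_ rfl
    rw [neg_sq]; push_cast; rw [neg_sq]
  set T := (Finset.Icc 1 (2 * (n : ℤ))).filter (fun t => t ^ 2 < 4 * (n : ℤ)) with hT
  have gT : ∀ t ∈ T, g t = ((1 / 3 * (ff t * ∑ Q ∈ Sf (4 * n - t ^ 2), wt Q) : ℚ) : ℝ) := by
    intro t ht
    have h2 := (Finset.mem_filter.1 ht).2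
    have h4 := H_pos (4 * n - t ^ 2) (by linarith)
    simp only [hg]
    split_ifs with h
    · have : ff t = (t : ℚ) ^ 2 := by
        rw [ff_eq t ((ZMod.intCast_zmod_eq_zero_iff_dvd t 3).2 (by omega))]
      rw [this]
      rw [show hurwitzClassNumber (4 * n - t ^ 2) = 1 / 3 * (3 * hurwitzClassNumber (4 * n - t ^ 2)) by ring, h4]
      push_cast; ring
    · rw [ff_eq0 t (fun hz => h (by have := (ZMod.intCast_zmod_eq_zero_iff_dvd t 3).1 hz; omega))]; simp
  have g00 : ∀ t : ℤ, t ∉ T → -t ∉ T → g t = 0 := by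
    intro t h1 h2
    by_cases h0 : t = 0
    · rw [h0, g0]
    simp only [hg]
    rw [ite_eq_right_iff]
    intro h
    have hlt : 4 * (n : ℤ) - t ^ 2 < 0 := by
      by_contra hc
      have hne : t ^ 2 ≠ 4 * (n : ℤ) := by
        intro he
        obtain ⟨s, rfl⟩ : ∃ s, t = 3 * s := ⟨t / 3, by omega⟩
        apply h3
        have : (3 : ℤ) ∣ n := ⟨3 * s ^ 2 - n, by linarith⟩
        exact_mod_cast this
      have hlt : t ^ 2 < 4 * n := lt_of_le_of_ne (by linarith) hne
      rcases lt_or_gt_of_ne h0 with h | h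
      · apply h2
        rw [hT, Finset.mem_filter, Finset.mem_Icc]
        exact ⟨⟨by omega, by nlinarith⟩, by rw [neg_sq]; exact hlt⟩
      · apply h1
        rw [hT, Finset.mem_filter, Finset.mem_Icc]
        exact ⟨⟨by omega, by nlinarith⟩, hlt⟩
    rw [H_neg _ hlt, mul_zero]
  have hdis : Disjoint T (T.map (Equiv.neg ℤ).toEmbedding) := by
    rw [Finset.disjoint_left]
    intro t h1 h2
    rw [Finset.mem_map] at h2
    obtain ⟨s, h3, rfl⟩ := h2
    have a1 := (Finset.mem_Icc.1 (Finset.mem_filter.1 h1).1).1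
    have a2 := (Finset.mem_Icc.1 (Finset.mem_filter.1 h3).1).1
    simp at a1
    omega
  have e1 : HH 2 0 3 n = ∑ t ∈ T ∪ T.map (Equiv.neg ℤ).toEmbedding, g t := by
    unfold HH
    refine finsum_eq_sum_of_support_subset g ?_
    intro t ht
    by_contra hc
    apply ht
    simp only [Finset.coe_union, Set.mem_union, Finset.mem_coe, Finset.mem_map, not_or] at hc
    refine g00 t hc.1 ?_
    intro h
    exact hc.2 ⟨-t, h, by simp⟩
  rw [e1, Finset.sum_union hdis, Finset.sum_map]
  simp only [Equiv.coe_toEmbedding, Equiv.neg_apply, gneg]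
  rw [Finset.sum_congr rfl gT, link1 n hN, ← Rat.cast_sum, ← Rat.cast_add, ← Finset.mul_sum]
  congr 1
  ring

open PowerSeries in
/-- generating series of divisor sums -/
noncomputable def SS (u : ℤ → ℤ → ℚ) : PowerSeries ℚ := PowerSeries.mk (fun n => Ds (n : ℤ) u)

lemma coeff_SS (u : ℤ → ℤ → ℚ) (n : ℕ) : PowerSeries.coeff n (SS u) = Ds n u := by
  simp [SS]

lemma SS_add (u v : ℤ → ℤ → ℚ) : SS (fun d e => u d e + v d e) = SS u + SS v := by
  ext n; simp only [coeff_SS, map_add, Ds_add]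
lemma SS_sub (u v : ℤ → ℤ → ℚ) : SS (fun d e => u d e - v d e) = SS u - SS v := by
  ext n; simp only [coeff_SS, map_sub, Ds_sub]
lemma SS_smul (c : ℚ) (u : ℤ → ℤ → ℚ) : SS (fun d e => c * u d e) = PowerSeries.C c * SS u := by
  ext n; simp only [coeff_SS, PowerSeries.coeff_C_mul, Ds_smul]

lemma SS_sym (u v : ℤ → ℤ → ℚ) (H : ∀ d e, 0 < d → 0 < e → u d e + u e d = v d e + v e d) : SS u = SS v := by
  ext n; rw [coeff_SS, coeff_SS]; exact Ds_sym fun d e hd he _ => H d e hd he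

lemma coeff_mul_SS (u v : ℤ → ℤ → ℚ) (n : ℕ) :
    PowerSeries.coeff n (SS u * SS v) = Ks n (fun A D x y => u A D * v x y) := by
  rw [PowerSeries.coeff_mul]
  simp only [coeff_SS]
  unfold Ds Ks
  simp_rw [Finset.sum_mul_sum]
  simp_rw [← Finset.sum_product']
  rw [Finset.sum_sigma']
  refine Finset.sum_nbij' (fun w => (w.2.1.1, w.2.1.2, w.2.2.1, w.2.2.2))
    (fun v => ⟨((v.1 * v.2.1).toNat, (v.2.2.1 * v.2.2.2).toNat), ((v.1, v.2.1), (v.2.2.1, v.2.2.2))⟩) ?_ ?_ ?_ ?_ ?_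
  · rintro ⟨⟨i, j⟩, ⟨A, D⟩, x, y⟩
    simp only [Finset.mem_sigma, Finset.HasAntidiagonal.mem_antidiagonal, Finset.mem_product, mem_D, mem_K]
    rintro ⟨h1, ⟨h2, h3, h4⟩, h5, h6, h7⟩
    exact ⟨h2, h3, h5, h6, by rw [h4, h7]; exact_mod_cast h1⟩
  · rintro ⟨A, D, x, y⟩
    simp only [Finset.mem_sigma, Finset.HasAntidiagonal.mem_antidiagonal, Finset.mem_product, mem_D, mem_K]
    rintro ⟨h1, h2, h3, h4, h5⟩
    have p1 := mul_pos h1 h2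
    have p2 := mul_pos h3 h4
    exact ⟨by omega, ⟨h1, h2, by omega⟩, h3, h4, by omega⟩
  · rintro ⟨⟨i, j⟩, ⟨A, D⟩, x, y⟩
    simp only [Finset.mem_sigma, Finset.HasAntidiagonal.mem_antidiagonal, Finset.mem_product, mem_D]
    rintro ⟨h1, ⟨h2, h3, h4⟩, h5, h6, h7⟩
    rw [h4, h7]
    simp
  · rintro ⟨A, D, x, y⟩ _
    rfl
  · rintro ⟨⟨i, j⟩, ⟨A, D⟩, x, y⟩ _
    rfl

/-- `q d/dq` -/
noncomputable def Dq (f : PowerSeries ℚ) : PowerSeries ℚ := PowerSeries.X * PowerSeries.derivative ℚ f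

lemma coeff_Dq (f : PowerSeries ℚ) (n : ℕ) : PowerSeries.coeff n (Dq f) = n * PowerSeries.coeff n f := by
  unfold Dq
  cases n with
  | zero => simp
  | succ n => rw [PowerSeries.coeff_succ_X_mul, PowerSeries.coeff_derivative]; push_cast; ring

lemma Dq_add (f g : PowerSeries ℚ) : Dq (f + g) = Dq f + Dq g := by simp [Dq, mul_add]
lemma Dq_sub (f g : PowerSeries ℚ) : Dq (f - g) = Dq f - Dq g := by simp [Dq, mul_sub]
lemma Dq_one : Dq 1 = 0 := by simp [Dq]
lemma Dq_mul (f g : PowerSeries ℚ) : Dq (f * g) = f * Dq g + g * Dq f := by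
  simp only [Dq, Derivation.leibniz, smul_eq_mul]; ring
lemma Dq_C (c : ℚ) : Dq (PowerSeries.C c) = 0 := by simp [Dq]

/-- supported on a residue class -/
def sup3 (r : ZMod 3) (f : PowerSeries ℚ) : Prop := ∀ n : ℕ, (n : ZMod 3) ≠ r → PowerSeries.coeff n f = 0

lemma sup_mul {r s : ZMod 3} {f g : PowerSeries ℚ} (hf : sup3 r f) (hg : sup3 s g) : sup3 (r + s) (f * g) := by
  intro n hn
  rw [PowerSeries.coeff_mul]
  refine Finset.sum_eq_zero ?_
  rintro ⟨i, j⟩ hij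
  rw [Finset.HasAntidiagonal.mem_antidiagonal] at hij
  by_cases hi : (i : ZMod 3) = r
  · have hj : (j : ZMod 3) ≠ s := by
      rintro rfl
      apply hn
      rw [← hi, ← hij]; push_cast; rfl
    simp [hg j hj]
  · simp [hf i hi]

lemma sup_add {r : ZMod 3} {f g : PowerSeries ℚ} (hf : sup3 r f) (hg : sup3 r g) : sup3 r (f + g) := by
  intro n hn; rw [map_add, hf n hn, hg n hn, add_zero]
lemma sup_sub {r : ZMod 3} {f g : PowerSeries ℚ} (hf : sup3 r f) (hg : sup3 r g) : sup3 r (f - g) := by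
  intro n hn; rw [map_sub, hf n hn, hg n hn, sub_zero]
lemma sup_C {r : ZMod 3} {f : PowerSeries ℚ} (c : ℚ) (hf : sup3 r f) : sup3 r (PowerSeries.C c * f) := by
  intro n hn; rw [PowerSeries.coeff_C_mul, hf n hn, mul_zero]
lemma sup_Dq {r : ZMod 3} {f : PowerSeries ℚ} (hf : sup3 r f) : sup3 r (Dq f) := by
  intro n hn; rw [coeff_Dq, hf n hn, mul_zero]
lemma sup_ext {r : ZMod 3} {f g : PowerSeries ℚ} (hf : sup3 r f) (hg : sup3 r g)
    (H : ∀ n : ℕ, (n : ZMod 3) = r → PowerSeries.coeff n f = PowerSeries.coeff n g) : f = g := by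
  ext n
  by_cases h : (n : ZMod 3) = r
  · exact H n h
  · rw [hf n h, hg n h]

lemma sup_SS {r : ZMod 3} (u : ℤ → ℤ → ℚ) (H : ∀ d e : ℤ, (d : ZMod 3) * (e : ZMod 3) ≠ r → u d e = 0) : sup3 r (SS u) := by
  intro n hn
  rw [coeff_SS]
  refine Finset.sum_eq_zero ?_
  rintro ⟨d, e⟩ h
  rw [mem_D] at h
  refine H d e ?_
  rintro h'
  apply hn
  rw [← h', ← Int.cast_mul, h.2.2]; simp

lemma Dq_SS (u : ℤ → ℤ → ℚ) : Dq (SS u) = SS (fun d e => d * e * u d e) := by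
  ext n
  rw [coeff_Dq, coeff_SS, coeff_SS, ← Ds_smul]
  refine Ds_congr fun d e _ _ h => ?_
  rw [← Int.cast_mul, h]; simp

/-- rescaling of divisor sums -/
lemma Ds_three (m : ℤ) (u : ℤ → ℤ → ℚ) : Ds (3 * m) (fun d e => i3 d * u d e) = Ds m (fun d e => u (3 * d) e) := by
  unfold Ds
  have : ∑ v ∈ Dset (3 * m), i3 v.1 * u v.1 v.2 = ∑ v ∈ (Dset (3 * m)).filter (fun v => v.1 % 3 = 0), u v.1 v.2 := by
    rw [Finset.sum_filter]
    refine Finset.sum_congr rfl fun v _ => ?_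
    have : ((v.1 : ZMod 3) = 0) ↔ v.1 % 3 = 0 := by
      rw [ZMod.intCast_zmod_eq_zero_iff_dvd]; omega
    simp only [i3, I3, this]
    split_ifs <;> simp
  rw [this]
  refine Finset.sum_nbij' (fun v => (v.1 / 3, v.2)) (fun v => (3 * v.1, v.2)) ?_ ?_ ?_ ?_ ?_
  · rintro ⟨d, e⟩
    simp only [Finset.mem_filter, mem_D]
    rintro ⟨⟨h1, h2, h3⟩, h4⟩
    obtain ⟨k, rfl⟩ : ∃ k, d = 3 * k := ⟨d / 3, by omega⟩
    rw [Int.mul_ediv_cancel_left _ (by norm_num)]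
    exact ⟨by omega, h2, by linarith⟩
  · rintro ⟨d, e⟩
    simp only [Finset.mem_filter, mem_D]
    rintro ⟨h1, h2, h3⟩
    exact ⟨⟨by omega, h2, by linarith⟩, by omega⟩
  · rintro ⟨d, e⟩
    simp only [Finset.mem_filter, mem_D, Prod.mk.injEq]
    rintro ⟨⟨h1, h2, h3⟩, h4⟩
    exact ⟨by omega, trivial⟩
  · rintro ⟨d, e⟩ _
    simp
  · rintro ⟨d, e⟩
    simp only [Finset.mem_filter, mem_D]
    rintro ⟨⟨h1, h2, h3⟩, h4⟩
    congr 1; omega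

lemma Ds_three' (m : ℤ) (u : ℤ → ℤ → ℚ) : Ds (3 * m) (fun d e => i3 e * u d e) = Ds m (fun d e => u d (3 * e)) := by
  rw [Ds_rev, Ds_three m (fun e d => u d e), Ds_rev]

/-- rescaling of convolution sums -/
lemma coeff_three (u v : ℤ → ℤ → ℚ) (m : ℕ) :
    PowerSeries.coeff (3 * m) (SS (fun d e => i3 d * u d e) * SS (fun d e => i3 e * v d e)) =
    PowerSeries.coeff m (SS (fun d e => u (3 * d) e) * SS (fun d e => v d (3 * e))) := by
  rw [PowerSeries.coeff_mul, PowerSeries.coeff_mul]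
  have e0 : ∀ k : ℕ, k % 3 ≠ 0 → PowerSeries.coeff k (SS (fun d e => i3 d * u d e)) = 0 := by
    intro k hk
    refine sup_SS (r := 0) _ ?_ k ?_
    · intro d e h
      have : (d : ZMod 3) ≠ 0 := left_ne_zero_of_mul h
      simp [i3, I3, this]
    · rw [Ne, ZMod.natCast_eq_zero_iff]; omega
  rw [← Finset.sum_filter_of_ne (p := fun v : ℕ × ℕ => v.1 % 3 = 0)]
  · symm
    refine Finset.sum_nbij' (fun v => (3 * v.1, 3 * v.2)) (fun v => (v.1 / 3, v.2 / 3)) ?_ ?_ ?_ ?_ ?_ <;> rintro ⟨i, j⟩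
    · simp only [Finset.mem_filter, Finset.HasAntidiagonal.mem_antidiagonal]; omega
    · simp only [Finset.mem_filter, Finset.HasAntidiagonal.mem_antidiagonal]; omega
    · intro _; simp
    · simp only [Finset.mem_filter, Finset.HasAntidiagonal.mem_antidiagonal, Prod.mk.injEq]; omega
    · intro _
      simp only [coeff_SS]
      push_cast
      rw [Ds_three, Ds_three']
  · rintro ⟨i, j⟩ _ h
    by_contra hc
    apply h
    rw [e0 i hc, zero_mul]

open PowerSeries (coeff)

lemma split3 {f0 f1 f2 g0 g1 g2 : PowerSeries ℚ} (h0 : sup3 0 f0) (h1 : sup3 1 f1) (h2 : sup3 2 f2)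
    (k0 : sup3 0 g0) (k1 : sup3 1 g1) (k2 : sup3 2 g2) (H : f0 + f1 + f2 = g0 + g1 + g2) :
    f0 = g0 ∧ f1 = g1 ∧ f2 = g2 := by
  have H' : ∀ n, coeff n f0 + coeff n f1 + coeff n f2 = coeff n g0 + coeff n g1 + coeff n g2 := by
    intro n; simpa only [map_add] using congrArg (coeff n) H
  have n01 : (0 : ZMod 3) ≠ 1 := by decide
  have n02 : (0 : ZMod 3) ≠ 2 := by decide
  have n12 : (1 : ZMod 3) ≠ 2 := by decide
  refine ⟨sup_ext h0 k0 ?_, sup_ext h1 k1 ?_, sup_ext h2 k2 ?_⟩ <;> intro n hn <;> have := H' n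
  · rw [h1 n (by rw [hn]; exact n01), h2 n (by rw [hn]; exact n02), k1 n (by rw [hn]; exact n01), k2 n (by rw [hn]; exact n02)] at this
    linarith
  · rw [h0 n (by rw [hn]; exact n01.symm), h2 n (by rw [hn]; exact n12), k0 n (by rw [hn]; exact n01.symm), k2 n (by rw [hn]; exact n12)] at this
    linarith
  · rw [h0 n (by rw [hn]; exact n02.symm), h1 n (by rw [hn]; exact n12.symm), k0 n (by rw [hn]; exact n02.symm), k1 n (by rw [hn]; exact n12.symm)] at this
    linarith

noncomputable def sB : PowerSeries ℚ := SS (fun d e => i3 e * c3 d)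
noncomputable def sC : PowerSeries ℚ := SS (fun d e => i3 (d * e - 1) * c3 d)
noncomputable def sC0 : PowerSeries ℚ := SS (fun d e => c3 d)
noncomputable def sP0 : PowerSeries ℚ := SS (fun d e => i3 e * ((1 - i3 d) * d))
noncomputable def sP1 : PowerSeries ℚ := SS (fun d e => i3 (d * e - 1) * d)
noncomputable def sP2 : PowerSeries ℚ := SS (fun d e => i3 (d * e + 1) * d)
noncomputable def sM : PowerSeries ℚ := SS (fun d e => i3 d * ((1 - i3 e) * d))
noncomputable def sR : PowerSeries ℚ := SS (fun d e => i3 e * d - 3 * (i3 d * i3 e * d))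
noncomputable def sG : PowerSeries ℚ := SS (fun d e => i3 e * d)
noncomputable def sE : PowerSeries ℚ := SS (fun d e => i3 d * (c3 e * d * d))

lemma supB : sup3 0 sB := sup_SS _ fun d e h => by
  have : (e : ZMod 3) ≠ 0 := right_ne_zero_of_mul h
  simp [i3, I3, this]
lemma supP0 : sup3 0 sP0 := sup_SS _ fun d e h => by
  have : (e : ZMod 3) ≠ 0 := right_ne_zero_of_mul h
  simp [i3, I3, this]
lemma supM : sup3 0 sM := sup_SS _ fun d e h => by
  have : (d : ZMod 3) ≠ 0 := left_ne_zero_of_mul h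
  simp [i3, I3, this]
lemma supE : sup3 0 sE := sup_SS _ fun d e h => by
  have : (d : ZMod 3) ≠ 0 := left_ne_zero_of_mul h
  simp [i3, I3, this]
lemma supR : sup3 0 sR := sup_SS _ fun d e h => by
  have : (e : ZMod 3) ≠ 0 := right_ne_zero_of_mul h
  simp [i3, I3, this]
lemma supC : sup3 1 sC := sup_SS _ fun d e h => by
  have : (d : ZMod 3) * e - 1 ≠ 0 := sub_ne_zero.2 h
  simp [i3, I3, this]
lemma supP1 : sup3 1 sP1 := sup_SS _ fun d e h => by
  have : (d : ZMod 3) * e - 1 ≠ 0 := sub_ne_zero.2 h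
  simp [i3, I3, this]
lemma supP2 : sup3 2 sP2 := sup_SS _ fun d e h => by
  have : (d : ZMod 3) * e + 1 ≠ 0 := by
    intro h'
    apply h
    rw [eq_neg_of_add_eq_zero_left h']; decide
  simp [i3, I3, this]

lemma C0_eq : sC0 = sC + sB := by
  unfold sC0 sC sB
  rw [← SS_add]
  refine SS_sym _ _ fun d e _ _ => ?_
  simp only [i3, c3]
  push_cast
  generalize (d : ZMod 3) = d0
  generalize (e : ZMod 3) = e0
  rcases z3cases d0 with rfl | rfl | rfl <;> rcases z3cases e0 with rfl | rfl | rfl <;>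
    simp (decide := true) [I3, X3]

lemma eqII : sB * sB = PowerSeries.C (1/3) * (sP0 - sB) ∧
    PowerSeries.C 2 * (sC * sB) = PowerSeries.C (1/3) * (sP1 - sC) ∧
    sC * sC = PowerSeries.C (1/3) * sP2 := by
  have h1 : sC0 * sC0 = SS (fun d _ => 1/3 * (d - i3 d * d - c3 d)) := by
    ext n
    rw [sC0, coeff_mul_SS, coeff_SS, ← valII]; rfl
  have h2 : SS (fun d _ => 1/3 * (d - i3 d * d - c3 d)) = PowerSeries.C (1/3) * (sP0 - sB) +
      PowerSeries.C (1/3) * (sP1 - sC) + PowerSeries.C (1/3) * sP2 := by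
    unfold sP0 sB sP1 sC sP2
    rw [← SS_sub, ← SS_sub, ← SS_smul, ← SS_smul, ← SS_smul, ← SS_add, ← SS_add]
    refine SS_sym _ _ fun d e _ _ => ?_
    simp only [i3, c3]
    push_cast
    generalize (d : ZMod 3) = d0
    generalize (e : ZMod 3) = e0
    rcases z3cases d0 with rfl | rfl | rfl <;> rcases z3cases e0 with rfl | rfl | rfl <;>
      simp (decide := true) [I3, X3] <;> ring
  refine split3 (sup_mul supB supB) (sup_C _ (sup_mul supC supB)) (sup_mul supC supC)
    (sup_C _ (sup_sub supP0 supB)) (sup_C _ (sup_sub supP1 supC)) (sup_C _ supP2) ?_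
  rw [← h2, ← h1, C0_eq, map_ofNat]; ring

lemma eqG : sR * sC = PowerSeries.C (1/3) * (Dq sC - sC) := by
  have s1 := sup_mul supR supC
  rw [zero_add] at s1
  refine sup_ext s1 (sup_C _ (sup_sub (sup_Dq supC) supC)) ?_
  intro n hn
  have h1 : coeff n (sR * sC) = coeff n (sR * sC0) := by
    rw [C0_eq, mul_add, map_add, sup_mul supR supB n (by rw [hn]; decide), add_zero]
  have hn' : ((n : ℤ) : ZMod 3) = 1 := by simpa using hn
  have h2 : coeff n (sR * sC0) = Ks n fG := by
    unfold sR sC0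
    rw [coeff_mul_SS]
    congr 1; ext A D x y
    unfold fG; ring
  rw [h1, h2, valG n hn', PowerSeries.coeff_C_mul, map_sub, coeff_Dq]
  unfold sC
  rw [coeff_SS, ← Ds_smul, ← Ds_sub, ← Ds_smul]
  refine Ds_congr fun d e _ _ h => ?_
  have : i3 (d * e - 1) = 1 := by
    unfold i3; rw [h]; push_cast; rw [hn]; decide
  rw [this, ← Int.cast_mul, h]; simp; ring

lemma G_scale : SS (fun d e => i3 d * d) = PowerSeries.C 3 * sG := by
  have sa : sup3 0 (SS (fun d e => i3 d * d)) := sup_SS _ fun d e h => by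
    have : (d : ZMod 3) ≠ 0 := left_ne_zero_of_mul h
    simp [i3, I3, this]
  have sb : sup3 0 sG := sup_SS _ fun d e h => by
    have : (e : ZMod 3) ≠ 0 := right_ne_zero_of_mul h
    simp [i3, I3, this]
  refine sup_ext sa (sup_C _ sb) ?_
  intro n hn
  rw [ZMod.natCast_eq_zero_iff] at hn
  obtain ⟨m, rfl⟩ := hn
  unfold sG
  rw [PowerSeries.coeff_C_mul, coeff_SS, coeff_SS]
  push_cast
  rw [Ds_three, Ds_three', ← Ds_smul]
  refine Ds_congr fun d e _ _ _ => ?_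
  push_cast; ring

lemma R_eq : PowerSeries.C 3 * sR = PowerSeries.C 12 * sP0 - PowerSeries.C 3 * sM := by
  have h := G_scale
  unfold sG at h
  have h2 : PowerSeries.C 3 * sR = PowerSeries.C 12 * sP0 - PowerSeries.C 3 * sM +
     PowerSeries.C 3 * (SS (fun d e => i3 d * d)) - PowerSeries.C 9 * SS (fun d e => i3 e * d) := by
    unfold sR sP0 sM
    simp only [← SS_smul, ← SS_add, ← SS_sub]
    congr 1; ext d e; ring
  rw [h2, h]
  simp only [map_ofNat]; ring

lemma P0M_eq : sP0 - sM = - PowerSeries.C 2 * sG := by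
  have h := G_scale
  have h2 : sP0 - sM = sG - SS (fun d e => i3 d * d) := by
    unfold sP0 sM sG
    simp only [← SS_smul, ← SS_add, ← SS_sub]
    congr 1; ext d e; ring
  rw [h2, h]
  simp only [map_ofNat]; ring

lemma eqY : sP2 * sC = PowerSeries.C (1/3) * sE := by
  have s1 := sup_mul supP2 supC
  rw [show (2 : ZMod 3) + 1 = 0 by decide] at s1
  refine sup_ext s1 (sup_C _ supE) ?_
  intro n hn
  have h1 : coeff n (sP2 * sC) = coeff n (sP2 * sC0) := by
    rw [C0_eq, mul_add, map_add, sup_mul supP2 supB n (by rw [hn]; decide), add_zero]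
  have hn' : ((n : ℤ) : ZMod 3) = 0 := by simpa using hn
  have h2 : coeff n (sP2 * sC0) = Ks n fY := by
    unfold sP2 sC0
    rw [coeff_mul_SS]
    congr 1; ext A D x y
    unfold fY; ring
  rw [h1, h2, valY n hn', PowerSeries.coeff_C_mul]
  unfold sE
  rw [coeff_SS, ← Ds_smul]
  refine Ds_congr fun d e _ _ h => ?_
  ring

lemma eqX0 : SS (fun d e => (1 - i3 e) * d) * sC0 =
    SS (fun d e => -1/6 * (2 * d * e * c3 d + d - i3 e * d - 3 * c3 e * d * d)) := by
  ext n
  unfold sC0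
  rw [coeff_mul_SS, coeff_SS]
  rcases z3cases ((n : ℤ) : ZMod 3) with h | h | h
  · rw [← valX0 n h]; congr 1; ext A D x y; unfold fX0; ring
  · rw [← valX1 n h]; congr 1; ext A D x y; unfold fX1; ring
  · rw [← valX2 n h]; congr 1; ext A D x y; unfold fX2; ring

lemma i3_mul3 (e : ℤ) : i3 (3 * e) = 1 := by
  simp [i3, I3, three0]

lemma eqX : sM * sB = - PowerSeries.C (1/3) * Dq sB - PowerSeries.C (1/6) * sM + PowerSeries.C (1/6) * sE := by
  have s1 := sup_mul supM supB
  rw [add_zero] at s1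
  have e1 : - PowerSeries.C (1/3) * Dq sB - PowerSeries.C (1/6) * sM + PowerSeries.C (1/6) * sE =
     PowerSeries.C (-1/3) * Dq sB + PowerSeries.C (-1/6) * sM + PowerSeries.C (1/6) * sE := by
    rw [show (-1/3 : ℚ) = -(1/3) by norm_num, show (-1/6 : ℚ) = -(1/6) by norm_num, map_neg, map_neg]; ring
  rw [e1]
  refine sup_ext s1 (sup_add (sup_add (sup_C _ (sup_Dq supB)) (sup_C _ supM)) (sup_C _ supE)) ?_
  intro n hn
  rw [ZMod.natCast_eq_zero_iff] at hn
  obtain ⟨m, rfl⟩ := hn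
  have h1 : coeff (3 * m) (sM * sB) = 3 * coeff m (SS (fun d e => (1 - i3 e) * d) * sC0) := by
    unfold sM sB
    rw [coeff_three (fun d e => (1 - i3 e) * d) (fun d e => c3 d), ← PowerSeries.coeff_C_mul, ← mul_assoc, ← SS_smul]
    unfold sC0
    congr 3
    ext d e
    push_cast; ring
  rw [h1, eqX0, coeff_SS]
  simp only [map_add, PowerSeries.coeff_C_mul, coeff_Dq]
  unfold sM sB sE
  simp only [coeff_SS]
  push_cast
  rw [Ds_three, Ds_three, Ds_three', ← Ds_smul, ← Ds_smul, ← Ds_smul, ← Ds_smul, ← Ds_smul, ← Ds_add, ← Ds_add]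
  refine Ds_congr fun d e _ _ h => ?_
  have : (m : ℚ) = d * e := by rw [← Int.cast_mul, h]; simp
  rw [this]
  push_cast
  ring

noncomputable def sA : PowerSeries ℚ := 1 + PowerSeries.C 6 * sB
noncomputable def sL : PowerSeries ℚ := - PowerSeries.C 3 * sM
noncomputable def sW : PowerSeries ℚ := sA * Dq sC - sC * Dq sA

lemma C_third (f : PowerSeries ℚ) : PowerSeries.C 3 * (PowerSeries.C (1/3) * f) = f := by
  rw [← mul_assoc, ← map_mul]; norm_num
lemma C_sixth (f : PowerSeries ℚ) : PowerSeries.C 6 * (PowerSeries.C (1/6) * f) = f := by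
  rw [← mul_assoc, ← map_mul]; norm_num
lemma C_two (f : PowerSeries ℚ) : PowerSeries.C 6 * (PowerSeries.C (1/3) * f) = PowerSeries.C 2 * f := by
  rw [← mul_assoc, ← map_mul]; norm_num

lemma DA : Dq sA = 6 * Dq sB := by
  rw [sA, Dq_add, Dq_one, Dq_mul, Dq_C, map_ofNat]; ring

lemma A_sq : sA ^ 2 = 1 + 12 * sP0 := by
  have h := congrArg (fun f => 12 * (PowerSeries.C 3 * f)) eqII.1
  simp only [C_third] at h
  rw [map_ofNat] at h
  rw [sA, map_ofNat]
  linear_combination h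

lemma CA : sC * sA = sP1 := by
  have h := congrArg (fun f => (PowerSeries.C 3 * f)) eqII.2.1
  simp only [C_third] at h
  rw [map_ofNat, map_ofNat] at h
  rw [sA, map_ofNat]
  linear_combination h

lemma C_cube : 9 * sC ^ 3 = sE := by
  have h1 := congrArg (fun f => (PowerSeries.C 3 * f)) eqII.2.2
  have h2 := congrArg (fun f => (PowerSeries.C 3 * f)) eqY
  simp only [C_third] at h1 h2
  rw [map_ofNat] at h1 h2
  linear_combination 3 * sC * h1 + h2

lemma DC : Dq sC = sC * (sA ^ 2 + sL) := by
  have h1 := congrArg (fun f => (PowerSeries.C 3 * f)) eqG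
  simp only [C_third] at h1
  have h2 := R_eq
  rw [A_sq, sL]
  simp only [map_ofNat] at h1 h2 ⊢
  linear_combination -h1 + sC * h2

lemma DA' : Dq sA = sL * sA + 27 * sC ^ 3 := by
  have h1 := congrArg (fun f => (PowerSeries.C 6 * f)) eqX
  simp only [mul_add, mul_sub, neg_mul, mul_neg, C_sixth, C_two] at h1
  have h2 := C_cube
  rw [DA, sL, sA]
  simp only [map_ofNat] at h1 h2 ⊢
  linear_combination 3 * h1 - 3 * h2

lemma DW : Dq sW = sW * (1 - 24 * sG) := by
  have hW : sW = sC * (sA ^ 3 - 27 * sC ^ 3) := by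
    unfold sW; rw [DC, DA']; ring
  have e3 : Dq (27 : PowerSeries ℚ) = 0 := by
    have := Dq_C 27
    rwa [map_ofNat] at this
  have hG : sA ^ 2 + 4 * sL = 1 - 24 * sG := by
    have h := P0M_eq
    rw [A_sq, sL]
    simp only [map_ofNat] at h ⊢
    linear_combination 12 * h
  rw [← hG, hW]
  simp only [pow_succ, pow_zero, one_mul, Dq_mul, Dq_sub, e3, DC, DA']
  ring

lemma W_P1 : Dq sP1 - sW = 12 * (sC * Dq sB) := by
  rw [← CA, Dq_mul, sW, DA]; ring



lemma Ds_div (n : ℕ) (hn : 0 < n) (g : ℤ → ℤ → ℚ) : Ds n g = ∑ d ∈ n.divisors, g d ((n / d : ℕ) : ℤ) := by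
  unfold Ds
  refine Finset.sum_nbij' (fun v => v.1.toNat) (fun d => ((d : ℤ), ((n / d : ℕ) : ℤ))) ?_ ?_ ?_ ?_ ?_
  · rintro ⟨d, e⟩
    rw [mem_D, Nat.mem_divisors]
    rintro ⟨h1, h2, h3⟩
    refine ⟨⟨e.toNat, ?_⟩, hn.ne'⟩
    zify
    rw [Int.toNat_of_nonneg h1.le, Int.toNat_of_nonneg h2.le, h3]
  · intro d hd
    rw [Nat.mem_divisors] at hd
    obtain ⟨⟨e, rfl⟩, h⟩ := hd
    have h1 : 0 < d := Nat.pos_of_ne_zero (left_ne_zero_of_mul h)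
    have h2 : 0 < e := Nat.pos_of_ne_zero (right_ne_zero_of_mul h)
    rw [mem_D, Nat.mul_div_cancel_left _ h1]
    exact ⟨by omega, by omega, by push_cast; rfl⟩
  · rintro ⟨d, e⟩
    rw [mem_D]
    rintro ⟨h1, h2, h3⟩
    lift d to ℕ using h1.le
    lift e to ℕ using h2.le
    have h3 : d * e = n := by exact_mod_cast h3
    rw [← h3]
    simp only [Int.toNat_natCast]
    rw [Nat.mul_div_cancel_left _ (by omega)]
  · intro d hd
    simp
  · rintro ⟨d, e⟩
    rw [mem_D]
    rintro ⟨h1, h2, h3⟩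
    lift d to ℕ using h1.le
    lift e to ℕ using h2.le
    have h3 : d * e = n := by exact_mod_cast h3
    rw [← h3]
    simp only [Int.toNat_natCast]
    rw [Nat.mul_div_cancel_left _ (by omega)]

/-- geometric series -/
noncomputable def geo (k : ℕ) : PowerSeries ℚ := PowerSeries.mk (fun n => if 0 < n ∧ 3 * k ∣ n then 1 else 0)

lemma geo_mul (k : ℕ) (hk : 0 < k) : (1 - PowerSeries.X ^ (3 * k)) * geo k = PowerSeries.X ^ (3 * k) := by
  ext n
  rw [sub_mul, one_mul, map_sub, PowerSeries.coeff_X_pow_mul', PowerSeries.coeff_X_pow]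
  simp only [geo, PowerSeries.coeff_mk]
  by_cases h1 : 3 * k ≤ n
  · rw [if_pos h1]
    obtain ⟨m, rfl⟩ := Nat.exists_eq_add_of_le h1
    have e1 : 3 * k + m - 3 * k = m := by omega
    rw [e1]
    have e2 : 3 * k ∣ 3 * k + m ↔ 3 * k ∣ m := by simp
    simp only [e2]
    by_cases hm : m = 0
    · subst hm; simp [hk]
    · have a1 : 0 < 3 * k + m := by omega
      have a2 : 0 < m := by omega
      have a3 : ¬ (3 * k + m = 3 * k) := by omega
      simp only [a1, a2, a3, true_and, if_false, sub_self]
  · have a : ¬ (0 < n ∧ 3 * k ∣ n) := by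
      rintro ⟨h2, h3⟩
      exact h1 (Nat.le_of_dvd h2 h3)
    have b : ¬ (n = 3 * k) := by omega
    rw [if_neg h1, if_neg a, if_neg b]; simp

lemma Dq_pow (f : PowerSeries ℚ) (g : PowerSeries ℚ) (h : Dq f = f * g) (m : ℕ) : Dq (f ^ m) = f ^ m * (m * g) := by
  induction m with
  | zero => simp [Dq_one]
  | succ m ih => rw [pow_succ, Dq_mul, ih, h]; push_cast; ring

lemma Dq_fac (k : ℕ) (hk : 0 < k) : Dq (1 - PowerSeries.X ^ (3 * k)) = (1 - PowerSeries.X ^ (3 * k)) * (- (3 * k : PowerSeries ℚ) * geo k) := by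
  have h := geo_mul k hk
  have h2 : Dq (1 - PowerSeries.X ^ (3 * k)) = - (3 * k : PowerSeries ℚ) * PowerSeries.X ^ (3 * k) := by
    rw [Dq_sub, Dq_one]
    have hX : Dq PowerSeries.X = PowerSeries.X * 1 := by simp [Dq]
    rw [Dq_pow _ _ hX]; push_cast; ring
  rw [h2]; linear_combination (3 * k : PowerSeries ℚ) * h

lemma Dq_prod (s : Finset ℕ) (hs : ∀ k ∈ s, 0 < k) :
    Dq (∏ k ∈ s, (1 - PowerSeries.X ^ (3 * k)) ^ 8) = (∏ k ∈ s, (1 - PowerSeries.X ^ (3 * k)) ^ 8) *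
      (- 24 * ∑ k ∈ s, (k : PowerSeries ℚ) * geo k) := by
  induction s using Finset.induction_on with
  | empty => simp [Dq_one]
  | insert a s ha ih =>
    have h1 := ih (fun k hk => hs k (Finset.mem_insert_of_mem hk))
    rw [Finset.prod_insert ha, Finset.sum_insert ha, Dq_mul, h1,
      Dq_pow _ _ (Dq_fac a (hs a (Finset.mem_insert_self _ _)))]
    push_cast
    ring

lemma uniq (N : ℕ) (V W R T : PowerSeries ℚ) (hV : Dq V = V * (1 + R)) (hW : Dq W = W * (1 + T))
    (hRT : ∀ n ≤ N, coeff n R = coeff n T) (hR : coeff 0 R = 0)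
    (h1 : coeff 1 V = coeff 1 W) : ∀ n ≤ N, coeff n V = coeff n W := by
  intro n
  induction n using Nat.strong_induction_on with
  | _ n ih =>
    intro hn
    by_cases hn1 : n = 1
    · rw [hn1, h1]
    have a1 := congrArg (coeff n) hV
    have a2 := congrArg (coeff n) hW
    rw [coeff_Dq, mul_add, mul_one, map_add, PowerSeries.coeff_mul] at a1 a2
    have key : ∑ p ∈ Finset.HasAntidiagonal.antidiagonal n, coeff p.1 V * coeff p.2 R = ∑ p ∈ Finset.HasAntidiagonal.antidiagonal n, coeff p.1 W * coeff p.2 T := by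
      refine Finset.sum_congr rfl ?_
      rintro ⟨i, j⟩ hij
      rw [Finset.HasAntidiagonal.mem_antidiagonal] at hij
      simp only at hij ⊢
      rw [← hRT j (by omega)]
      by_cases hj : j = 0
      · rw [hj, hR]; simp
      · rw [ih i (by omega) (by omega)]
    rw [key] at a1
    have hne : (n : ℚ) - 1 ≠ 0 := by
      rw [sub_ne_zero]; exact_mod_cast hn1
    have : ((n : ℚ) - 1) * (coeff n V - coeff n W) = 0 := by linarith
    rcases mul_eq_zero.1 this with h | h
    · exact absurd h hne
    · linarith

lemma coeff_G (N n : ℕ) (hn : n ≤ N) : coeff n (∑ k ∈ Finset.Icc 1 N, (k : PowerSeries ℚ) * geo k) = coeff n sG := by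
  rw [map_sum]
  have e1 : ∀ k : ℕ, coeff n ((k : PowerSeries ℚ) * geo k) = if 0 < n ∧ 3 * k ∣ n then (k : ℚ) else 0 := by
    intro k
    rw [← map_natCast PowerSeries.C k, PowerSeries.coeff_C_mul, geo, PowerSeries.coeff_mk]
    simp
  simp only [e1]
  rcases Nat.eq_zero_or_pos n with rfl | hpos
  · simp only [lt_irrefl, false_and, if_false, Finset.sum_const_zero]
    unfold sG
    rw [coeff_SS, Ds]
    symm
    refine Finset.sum_eq_zero ?_
    rintro ⟨d, e⟩ h
    rw [mem_D] at h
    have := mul_pos h.1 h.2.1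
    simp at h
    omega
  · unfold sG
    rw [coeff_SS, Ds_div n hpos]
    have e2 : ∀ d ∈ n.divisors, i3 ((n / d : ℕ) : ℤ) * ((d : ℤ) : ℚ) = if 3 * d ∣ n then (d : ℚ) else 0 := by
      intro d hd
      rw [Nat.mem_divisors] at hd
      obtain ⟨⟨e, rfl⟩, h⟩ := hd
      have h1 : 0 < d := Nat.pos_of_ne_zero (left_ne_zero_of_mul h)
      rw [Nat.mul_div_cancel_left _ h1]
      have : 3 * d ∣ d * e ↔ 3 ∣ e := by rw [mul_comm 3 d, Nat.mul_dvd_mul_iff_left h1]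
      simp only [this, i3, I3]
      push_cast
      simp only [ZMod.natCast_eq_zero_iff]
      split_ifs <;> simp
    rw [Finset.sum_congr rfl e2]
    simp only [hpos, true_and]
    rw [← Finset.sum_filter, ← Finset.sum_filter]
    refine Finset.sum_congr ?_ fun _ _ => rfl
    ext k
    simp only [Finset.mem_filter, Finset.mem_Icc, Nat.mem_divisors]
    constructor
    · rintro ⟨_, h⟩; exact ⟨⟨dvd_of_mul_left_dvd h, hpos.ne'⟩, h⟩
    · rintro ⟨⟨h1, _⟩, h⟩
      exact ⟨⟨Nat.pos_of_dvd_of_pos h1 hpos, (Nat.le_of_dvd hpos h1).trans hn⟩, h⟩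

lemma coeff1_mul (f g : PowerSeries ℚ) : coeff 1 (f * g) = coeff 0 f * coeff 1 g + coeff 1 f * coeff 0 g := by
  rw [PowerSeries.coeff_mul]
  rw [Finset.Nat.antidiagonal_succ]; simp

lemma W_one : coeff 1 sW = 1 := by
  have h := congrArg (coeff 1) W_P1
  have hz : coeff 0 sC = 0 := supC 0 (by decide)
  have h12 : coeff 1 (12 * (sC * Dq sB)) = 0 := by
    rw [show (12 : PowerSeries ℚ) = PowerSeries.C 12 by rw [map_ofNat], PowerSeries.coeff_C_mul, coeff1_mul, hz, coeff_Dq, coeff_Dq]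
    simp
  have hp : coeff 1 sP1 = 1 := by
    unfold sP1
    rw [coeff_SS, Ds_div 1 one_pos]
    simp [i3, I3]
  rw [map_sub, coeff_Dq, h12, hp] at h
  push_cast at h
  linarith

lemma eta_eq (n : ℕ) (hn : 0 < n) : (etaCoeff n : ℚ) = coeff n sW := by
  set V : PowerSeries ℚ := PowerSeries.X * ∏ k ∈ Finset.Icc 1 n, (1 - PowerSeries.X ^ (3 * k)) ^ 8 with hV
  have h1 : (etaCoeff n : ℚ) = coeff n V := by
    unfold etaCoeff
    rw [← eq_intCast (Int.castRingHom ℚ), ← Polynomial.coeff_map, ← Polynomial.coeff_coe]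
    congr 1
    simp only [Polynomial.map_mul, Polynomial.map_X, Polynomial.map_prod, Polynomial.map_pow, Polynomial.map_sub, Polynomial.map_one]
    rw [hV, Polynomial.coe_mul, Polynomial.coe_X]
    congr 1
    rw [← Polynomial.coeToPowerSeries.ringHom_apply, map_prod]
    refine Finset.prod_congr rfl fun k _ => ?_
    simp
  rw [h1]
  refine uniq n V sW (-24 * ∑ k ∈ Finset.Icc 1 n, (k : PowerSeries ℚ) * geo k) (-24 * sG) ?_ ?_ ?_ ?_ ?_ n le_rfl
  · have hX : Dq PowerSeries.X = PowerSeries.X * 1 := by simp [Dq]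
    rw [hV, Dq_mul, Dq_prod _ (fun k hk => by rw [Finset.mem_Icc] at hk; omega), hX]
    ring
  · rw [DW]; ring
  · intro m hm
    rw [show (-24 : PowerSeries ℚ) = PowerSeries.C (-24) by rw [map_neg, map_ofNat], PowerSeries.coeff_C_mul, PowerSeries.coeff_C_mul, coeff_G n m hm]
  · rw [show (-24 : PowerSeries ℚ) = PowerSeries.C (-24) by rw [map_neg, map_ofNat], PowerSeries.coeff_C_mul, coeff_G n 0 (Nat.zero_le _)]
    unfold sG
    rw [coeff_SS]
    have : Dset ((0 : ℕ) : ℤ) = ∅ := by decide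
    rw [Ds, this]; simp
  · rw [W_one, hV, show (1 : ℕ) = 0 + 1 from rfl, PowerSeries.coeff_succ_X_mul]
    rw [PowerSeries.coeff_zero_eq_constantCoeff_apply]
    simp
    refine Finset.prod_eq_one ?_
    intro k hk
    rw [Finset.mem_Icc] at hk
    simp [show k ≠ 0 by omega]

lemma Ks_g0 (n : ℕ) (hn : 0 < n) (h1 : (n : ZMod 3) = 1) :
    Ks n g0 = 1 / 12 * (n * (∑ d ∈ n.divisors, (d : ℚ)) - etaCoeff n) := by
  have h := congrArg (coeff n) W_P1
  rw [map_sub, coeff_Dq, ← eta_eq n hn, show (12 : PowerSeries ℚ) = PowerSeries.C 12 by rw [map_ofNat], PowerSeries.coeff_C_mul] at h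
  have e1 : coeff n sP1 = ∑ d ∈ n.divisors, (d : ℚ) := by
    unfold sP1
    rw [coeff_SS]
    have : Ds n (fun d e => i3 (d * e - 1) * d) = Ds n (fun d e => d) := by
      refine Ds_congr fun d e _ _ h => ?_
      have : i3 (d * e - 1) = 1 := by
        unfold i3; rw [h]; push_cast; rw [h1]; decide
      rw [this, one_mul]
    rw [this, Ds_div n hn]; simp
  have e2 : coeff n (sC * Dq sB) = Ks n g0 := by
    have s0 : coeff n (sB * Dq sB) = 0 := sup_mul supB (sup_Dq supB) n (by rw [h1]; decide)
    have : coeff n (sC * Dq sB) = coeff n (Dq sB * sC0) := by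
      rw [C0_eq, mul_add, map_add, mul_comm (Dq sB) sB, s0, add_zero, mul_comm]
    rw [this]
    unfold sB sC0
    rw [Dq_SS, coeff_mul_SS]
    congr 1; ext A D x y
    unfold g0; ring
  rw [e1, e2] at h
  linarith

/-- Theorem 1.1 (1), case `m = 0`:
for `3 ∤ n`,
`H_{2,0,3}(n) = -2 δ_{n ≡ 2 (3)} ∑_{d∣n, d²<n} d³ +`
`(½ n σ(n) - ½ a(n)` if `n ≡ 1 (3)`; `n σ(n) - 2n ∑_{d∣n, d²<n} d` if `n ≡ 2 (3))`. -/
theorem second_moment_m_eq_zero_three_not_dvd (n : ℕ) (hn : 0 < n) (h3 : ¬ 3 ∣ n) :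
    HH 2 0 3 n =
      -2 * (if n % 3 = 2 then (1 : ℝ) else 0) *
          (∑ d ∈ n.divisors.filter (fun d => d ^ 2 < n), (d : ℝ) ^ 3)
      + (if n % 3 = 1 then
            (n : ℝ) * (∑ d ∈ n.divisors, (d : ℝ)) / 2 - (etaCoeff n : ℝ) / 2
          else
            (n : ℝ) * (∑ d ∈ n.divisors, (d : ℝ))
              - 2 * (n : ℝ) * ∑ d ∈ n.divisors.filter (fun d => d ^ 2 < n), (d : ℝ)) := by
  have hd : (n % 3 = 1) ∨ (n % 3 = 2) := by omega
  rw [link n hn h3]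
  rcases hd with h | h
  · have h1 : (n : ZMod 3) = 1 := by
      rw [← Nat.cast_one, ZMod.natCast_eq_natCast_iff']; exact h
    have h2 : (((n : ℤ)) : ZMod 3) = 1 := by simpa using h1
    rw [if_neg (by omega), if_pos h, caseA n h2, Ks_g0 n hn h1]
    push_cast
    ring
  · have h1 : (n : ZMod 3) = 2 := by
      have : ((2 : ℕ) : ZMod 3) = 2 := by decide
      rw [← this, ZMod.natCast_eq_natCast_iff']; exact h
    have h2 : (((n : ℤ)) : ZMod 3) = 2 := by simpa using h1
    have h4 := caseB n h2
    rw [if_pos h, if_neg (by omega)]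
    rw [Ds_div n hn] at h4
    have h5 : TW n ff = 3 / 2 * ((n : ℚ) * ∑ d ∈ n.divisors, (d : ℚ) -
        2 * n * ∑ d ∈ n.divisors.filter (fun d => d ^ 2 < n), (d : ℚ) -
        2 * ∑ d ∈ n.divisors.filter (fun d => d ^ 2 < n), (d : ℚ) ^ 3) := by
      rw [Finset.sum_filter, Finset.sum_filter, Finset.mul_sum, Finset.mul_sum, Finset.mul_sum,
        ← Finset.sum_sub_distrib, ← Finset.sum_sub_distrib, Finset.mul_sum]
      have h6 : ∀ x : ℚ, ∀ y : ℚ, 2 * x = y → x = 1 / 2 * y := fun x y h => by linarith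
      rw [h6 _ _ h4, Finset.mul_sum]
      refine Finset.sum_congr rfl fun d hd => ?_
      obtain ⟨⟨e, rfl⟩, h0⟩ := Nat.mem_divisors.1 hd
      have hdp : 0 < d := Nat.pos_of_ne_zero (left_ne_zero_of_mul h0)
      rw [Nat.mul_div_cancel_left _ hdp]
      have hiff : ((d : ℤ) < (e : ℤ)) ↔ d ^ 2 < d * e := by
        rw [sq, Nat.mul_lt_mul_left hdp]; exact Int.ofNat_lt
      simp only [hiff]
      push_cast
      split_ifs <;> ring
    rw [h5]
    push_cast
    ring

end HurwitzPaper
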